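/- There exist constants ε₀ > 0 and C > 0 such that if ε ≤ ε₀ and f is a (1+ε)-biLipschitz self map of ℍ, then for every metric ball B in ℍ one has (1/ℒ(B)) ∫_B exp(‖Jf(Q) − (Jf)_B‖ / (C ε^{1/4096})) dQ ≤ 2, where Jf is the a.e.-defined Pansu Jacobian matrix of f and (Jf)_B = (1/ℒ(B)) ∫_B Jf is its average over B. -/

import Mathlib

noncomputable section

open MeasureTheory

/-- Points of the Heisenberg group `ℍ`, identified with `ℝ³ ≅ ℂ × ℝ`:
`(x, y, t)` corresponds to `(z ; t)` with `z = x + iy`. -/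
abbrev H : Type := ℝ × ℝ × ℝ

/-- The Heisenberg group law
`(x,y,t)·(x',y',t') = (x+x', y+y', t+t'+2(x'y − xy'))`. -/
def Hmul (p q : H) : H :=
  (p.1 + q.1, p.2.1 + q.2.1, p.2.2 + q.2.2 + 2 * (q.1 * p.2.1 - p.1 * q.2.1))

/-- The Heisenberg group inverse. -/
def Hinv (p : H) : H := (-p.1, -p.2.1, -p.2.2)

/-- The identity `O = (0,0,0)`. -/
def HO : H := (0, 0, 0)

/-- The control (Carnot–Carathéodory) distance: the infimum of the lengths
`∫₀¹ √(a(s)² + b(s)²) ds` of horizontal Lipschitz curves `γ` joining `P` to `Q`,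
i.e. curves satisfying a.e. `γ' = a·X(γ) + b·Y(γ)` where `X = ∂ₓ + 2y∂_t` and
`Y = ∂_y − 2x∂_t`. -/
def dH (P Q : H) : ℝ :=
  sInf { L : ℝ | ∃ (γ : ℝ → H) (a b : ℝ → ℝ) (K : NNReal),
    LipschitzWith K γ ∧ γ 0 = P ∧ γ 1 = Q ∧
    (∀ᵐ s ∂volume, s ∈ Set.Icc (0:ℝ) 1 →
      HasDerivAt γ (a s, b s, 2 * (γ s).2.1 * a s - 2 * (γ s).1 * b s) s) ∧
    IntervalIntegrable (fun s => Real.sqrt (a s ^ 2 + b s ^ 2)) volume 0 1 ∧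
    L = ∫ s in (0:ℝ)..1, Real.sqrt (a s ^ 2 + b s ^ 2) }

/-- `γ : ℝ → ℍ` is a `(1+ε)`-quasigeodesic. -/
def IsQuasiGeodesic (ε : ℝ) (γ : ℝ → H) : Prop :=
  ∀ s s' : ℝ, (1 + ε)⁻¹ * |s - s'| ≤ dH (γ s) (γ s') ∧
    dH (γ s) (γ s') ≤ (1 + ε) * |s - s'|

/-- `f : ℍ → ℍ` is `(1+ε)`-biLipschitz for the control distance. -/
def IsBiLip (ε : ℝ) (f : H → H) : Prop :=
  ∀ P Q : H, (1 + ε)⁻¹ * dH P Q ≤ dH (f P) (f Q) ∧ dH (f P) (f Q) ≤ (1 + ε) * dH P Q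

/-- `(a,b)` is the horizontal speed of `γ`: a.e. `γ'(s) = a(s)X(γ(s)) + b(s)Y(γ(s))`. -/
def HasHorizSpeed (γ : ℝ → H) (a b : ℝ → ℝ) : Prop :=
  ∀ᵐ s ∂volume, HasDerivAt γ (a s, b s, 2 * (γ s).2.1 * a s - 2 * (γ s).1 * b s) s

/-- The Heisenberg dilation `δ_λ(z;t) = (λz; λ²t)`. -/
def Hdil (l : ℝ) (p : H) : H := (l * p.1, l * p.2.1, l ^ 2 * p.2.2)

/-- `f` is Pansu differentiable at `P` with Pansu Jacobian the `2×2` matrix `A`: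
`δ_{1/σ}(f(P)⁻¹ · f(P · δ_σ(u,v,w)))` converges, as `σ → 0⁺` and uniformly on
compact sets of `(u,v,w)`, to `(A(u,v); det(A)·w)`. -/
def HasPansuJacobianAt (f : H → H) (A : Matrix (Fin 2) (Fin 2) ℝ) (P : H) : Prop :=
  ∀ K : Set H, IsCompact K → ∀ δ : ℝ, 0 < δ → ∃ σ₀ > (0:ℝ), ∀ σ : ℝ, 0 < σ → σ < σ₀ →
    ∀ Q ∈ K,
      dist (Hdil σ⁻¹ (Hmul (Hinv (f P)) (f (Hmul P (Hdil σ Q)))))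
        ((A 0 0 * Q.1 + A 0 1 * Q.2.1, A 1 0 * Q.1 + A 1 1 * Q.2.1,
          A.det * Q.2.2) : H) < δ

/-- The operator norm of a `2×2` real matrix (acting on Euclidean `ℝ²`). -/
def matOpNorm (A : Matrix (Fin 2) (Fin 2) ℝ) : ℝ :=
  sSup { r : ℝ | ∃ x y : ℝ, x ^ 2 + y ^ 2 ≤ 1 ∧
    r = Real.sqrt ((A 0 0 * x + A 0 1 * y) ^ 2 + (A 1 0 * x + A 1 1 * y) ^ 2) }


def RS (P Q : H) : Set ℝ := { L : ℝ | ∃ (γ : ℝ → H) (a b : ℝ → ℝ) (K : NNReal),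
    LipschitzWith K γ ∧ γ 0 = P ∧ γ 1 = Q ∧
    (∀ᵐ s ∂volume, s ∈ Set.Icc (0:ℝ) 1 →
      HasDerivAt γ (a s, b s, 2 * (γ s).2.1 * a s - 2 * (γ s).1 * b s) s) ∧
    IntervalIntegrable (fun s => Real.sqrt (a s ^ 2 + b s ^ 2)) volume 0 1 ∧
    L = ∫ s in (0:ℝ)..1, Real.sqrt (a s ^ 2 + b s ^ 2) }

lemma dH_eq (P Q : H) : dH P Q = sInf (RS P Q) := rfl

lemma RS_nonneg {P Q : H} {L : ℝ} (h : L ∈ RS P Q) : 0 ≤ L := by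
  obtain ⟨γ, a, b, K, _, _, _, _, _, rfl⟩ := h
  exact intervalIntegral.integral_nonneg zero_le_one fun s _ => Real.sqrt_nonneg _

lemma RS_bdd (P Q : H) : BddBelow (RS P Q) := ⟨0, fun _ h => RS_nonneg h⟩

lemma ftc_le {φ φ' w : ℝ → ℝ} {K : NNReal} (hφ : LipschitzWith K φ)
    (hd : ∀ᵐ s ∂volume, s ∈ Set.Icc (0:ℝ) 1 → HasDerivAt φ (φ' s) s)
    (hw : IntervalIntegrable w volume 0 1)
    (hle : ∀ s, s ∈ Set.Icc (0:ℝ) 1 → φ' s ≤ w s) {σ : ℝ} (h0 : 0 ≤ σ) (h1 : σ ≤ 1) :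
    φ σ - φ 0 ≤ ∫ s in (0:ℝ)..σ, w s := by
  have hac : AbsolutelyContinuousOnInterval φ 0 σ :=
    (hφ.lipschitzOnWith (s := Set.uIcc 0 σ)).absolutelyContinuousOnInterval
  rw [← hac.integral_deriv_eq_sub]
  apply intervalIntegral.integral_mono_ae_restrict h0 hac.intervalIntegrable_deriv
  · exact hw.mono_set (by
      rw [Set.uIcc_of_le h0, Set.uIcc_of_le zero_le_one]; exact Set.Icc_subset_Icc_right h1)
  · rw [Filter.EventuallyLE, ae_restrict_iff' measurableSet_Icc]
    filter_upwards [hd] with s hs hmem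
    have hm : s ∈ Set.Icc (0:ℝ) 1 := ⟨hmem.1, hmem.2.trans h1⟩
    rw [(hs hm).deriv]
    exact hle s hm

lemma lin_le_sqrt (u v a b : ℝ) :
    u * a + v * b ≤ Real.sqrt (u ^ 2 + v ^ 2) * Real.sqrt (a ^ 2 + b ^ 2) := by
  rw [← Real.sqrt_mul (by positivity)]
  apply Real.le_sqrt_of_sq_le
  nlinarith [sq_nonneg (u * b - v * a)]

lemma lipx {γ : ℝ → H} {K : NNReal} (h : LipschitzWith K γ) (u v w : ℝ) :
    ∃ K', LipschitzWith K' fun s => u * (γ s).1 + v * (γ s).2.1 + w * (γ s).2.2 := by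
  let l : H →ₗ[ℝ] ℝ :=
    { toFun := fun q => u * q.1 + v * q.2.1 + w * q.2.2
      map_add' := by intro p q; simp; ring
      map_smul' := by intro c q; simp; ring }
  exact ⟨_, (l.toContinuousLinearMap.lipschitz).comp h⟩

lemma dlin {γ : ℝ → H} {γ' : H} {s : ℝ} (h : HasDerivAt γ γ' s) (u v w : ℝ) :
    HasDerivAt (fun s => u * (γ s).1 + v * (γ s).2.1 + w * (γ s).2.2)
      (u * γ'.1 + v * γ'.2.1 + w * γ'.2.2) s := by
  let l : H →ₗ[ℝ] ℝ :=
    { toFun := fun q => u * q.1 + v * q.2.1 + w * q.2.2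
      map_add' := by intro p q; simp; ring
      map_smul' := by intro c q; simp; ring }
  exact (l.toContinuousLinearMap.hasFDerivAt (x := γ s)).comp_hasDerivAt s h

lemma hda_congr {γ : ℝ → H} {v w : H} {s : ℝ} (h : HasDerivAt γ v s) (e1 : w.1 = v.1)
    (e2 : w.2.1 = v.2.1) (e3 : w.2.2 = v.2.2) : HasDerivAt γ w s := by
  have : w = v := by ext <;> assumption
  rw [this]; exact h

lemma curve_hor {γ : ℝ → H} {a b : ℝ → ℝ} {K : NNReal} (hγ : LipschitzWith K γ)
    (hd : ∀ᵐ s ∂volume, s ∈ Set.Icc (0:ℝ) 1 →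
      HasDerivAt γ (a s, b s, 2 * (γ s).2.1 * a s - 2 * (γ s).1 * b s) s)
    (hi : IntervalIntegrable (fun s => Real.sqrt (a s ^ 2 + b s ^ 2)) volume 0 1)
    {σ : ℝ} (h0 : 0 ≤ σ) (h1 : σ ≤ 1) :
    Real.sqrt (((γ σ).1 - (γ 0).1) ^ 2 + ((γ σ).2.1 - (γ 0).2.1) ^ 2)
      ≤ ∫ s in (0:ℝ)..1, Real.sqrt (a s ^ 2 + b s ^ 2) := by
  set u := (γ σ).1 - (γ 0).1 with hu
  set v := (γ σ).2.1 - (γ 0).2.1 with hv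
  set N := Real.sqrt (u ^ 2 + v ^ 2) with hN
  set I := ∫ s in (0:ℝ)..1, Real.sqrt (a s ^ 2 + b s ^ 2) with hI
  have hI0 : 0 ≤ I := intervalIntegral.integral_nonneg zero_le_one fun s _ => Real.sqrt_nonneg _
  obtain ⟨K', hK'⟩ := lipx hγ u v 0
  have key := ftc_le hK' (φ' := fun s => u * a s + v * b s)
    (w := fun s => N * Real.sqrt (a s ^ 2 + b s ^ 2))
    (by filter_upwards [hd] with s hs hm
        simpa using dlin (hs hm) u v 0)
    (hi.const_mul N) (fun s _ => lin_le_sqrt _ _ _ _) h0 h1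
  rw [intervalIntegral.integral_const_mul] at key
  have hmono : ∫ s in (0:ℝ)..σ, Real.sqrt (a s ^ 2 + b s ^ 2) ≤ I := by
    apply intervalIntegral.integral_mono_interval le_rfl h0 h1 _ hi
    exact Filter.Eventually.of_forall fun s => Real.sqrt_nonneg _
  have hN0 : 0 ≤ N := Real.sqrt_nonneg _
  have hNN : N * N = u ^ 2 + v ^ 2 := Real.mul_self_sqrt (by positivity)
  have : N * N ≤ N * I := by
    have := mul_le_mul_of_nonneg_left hmono hN0
    rw [hNN]
    nlinarith
  by_contra hcon
  push Not at hcon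
  nlinarith

lemma RS_hor {P Q : H} {L : ℝ} (h : L ∈ RS P Q) :
    Real.sqrt ((Q.1 - P.1) ^ 2 + (Q.2.1 - P.2.1) ^ 2) ≤ L := by
  obtain ⟨γ, a, b, K, hγ, rfl, rfl, hd, hi, rfl⟩ := h
  exact curve_hor hγ hd hi zero_le_one le_rfl

lemma RS_vert {Q : H} {L : ℝ} (h : L ∈ RS HO Q) : |Q.2.2| ≤ 2 * L ^ 2 := by
  obtain ⟨γ, a, b, K, hγ, h0, rfl, hd, hi, hL⟩ := h
  have hL0 : 0 ≤ L := by
    rw [hL]; exact intervalIntegral.integral_nonneg zero_le_one fun s _ => Real.sqrt_nonneg _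
  have hxy : ∀ s ∈ Set.Icc (0:ℝ) 1, Real.sqrt ((γ s).2.1 ^ 2 + (γ s).1 ^ 2) ≤ L := by
    intro s hs
    have := curve_hor hγ hd hi hs.1 hs.2
    rw [h0] at this
    rw [hL, add_comm]
    simpa [HO] using this
  have main : ∀ e : ℝ, e ^ 2 = 1 → e * (γ 1).2.2 ≤ 2 * L ^ 2 := by
    intro e he
    obtain ⟨K', hK'⟩ := lipx hγ 0 0 e
    have key := ftc_le hK' (φ' := fun s => e * (2 * (γ s).2.1 * a s - 2 * (γ s).1 * b s))
      (w := fun s => (2 * L) * Real.sqrt (a s ^ 2 + b s ^ 2))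
      (by filter_upwards [hd] with s hs hm
          simpa using dlin (hs hm) 0 0 e)
      (hi.const_mul _) (fun s hs => by
        have h1 := lin_le_sqrt (e * (γ s).2.1) (-e * (γ s).1) (a s) (b s)
        have h2 : (e * (γ s).2.1) ^ 2 + (-e * (γ s).1) ^ 2 = (γ s).2.1 ^ 2 + (γ s).1 ^ 2 := by
          linear_combination ((γ s).2.1 ^ 2 + (γ s).1 ^ 2) * he
        rw [h2] at h1
        have h3 := mul_le_mul_of_nonneg_right (hxy s hs) (Real.sqrt_nonneg (a s ^ 2 + b s ^ 2))
        nlinarith) zero_le_one le_rfl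
    rw [intervalIntegral.integral_const_mul, ← hL, h0] at key
    simp [HO] at key
    nlinarith
  rw [abs_le]
  constructor
  · have := main (-1) (by norm_num); linarith
  · have := main 1 (by norm_num); linarith

def shl (R : H) (l : ℝ) : H →ₗ[ℝ] H :=
    { toFun := fun q => (l * q.1, l * q.2.1, l ^ 2 * q.2.2 + 2 * (l * q.1 * R.2.1 - R.1 * (l * q.2.1)))
      map_add' := by intro p q; ext <;> simp <;> ring
      map_smul' := by intro c q; ext <;> simp <;> ring }

lemma RS_shl {P Q : H} {L : ℝ} (h : L ∈ RS P Q) (R : H) {l : ℝ} (hl : 0 ≤ l) :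
    l * L ∈ RS (Hmul R (Hdil l P)) (Hmul R (Hdil l Q)) := by
  obtain ⟨γ, a, b, K, hγ, rfl, rfl, hd, hi, rfl⟩ := h
  have hc : ∀ q, Hmul R (Hdil l q) = R + (shl R l) q := by
    intro q; simp only [Hmul, Hdil, shl, LinearMap.coe_mk, AddHom.coe_mk]; ext <;> simp; ring
  have hsq : ∀ s, Real.sqrt ((l * a s) ^ 2 + (l * b s) ^ 2) = l * Real.sqrt (a s ^ 2 + b s ^ 2) := by
    intro s
    rw [show (l * a s) ^ 2 + (l * b s) ^ 2 = l ^ 2 * (a s ^ 2 + b s ^ 2) by ring,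
      Real.sqrt_mul (by positivity), Real.sqrt_sq hl]
  refine ⟨fun s => R + (shl R l).toContinuousLinearMap (γ s), fun s => l * a s, fun s => l * b s,
    0 + ‖(shl R l).toContinuousLinearMap‖₊ * K, ?_, ?_, ?_, ?_, ?_, ?_⟩
  · exact (LipschitzWith.const R).add ((shl R l).toContinuousLinearMap.lipschitz.comp hγ)
  · rw [hc]; rfl
  · rw [hc]; rfl
  · filter_upwards [hd] with s hs hm
    have := (((shl R l).toContinuousLinearMap.hasFDerivAt (x := γ s)).comp_hasDerivAt s
      (hs hm)).const_add R
    refine hda_congr this rfl rfl ?_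
    simp [shl]; ring
  · simp_rw [hsq]; exact hi.const_mul l
  · simp_rw [hsq]; rw [intervalIntegral.integral_const_mul]

lemma RS_seg (P : H) (x y : ℝ) : Real.sqrt (x ^ 2 + y ^ 2) ∈ RS P (Hmul P (x, y, 0)) := by
  let w : H := (x, y, 2 * (x * P.2.1 - P.1 * y))
  refine ⟨fun s => P + s • w, fun _ => x, fun _ => y, 0 + ‖w‖₊, ?_, by simp, ?_, ?_, ?_, by simp⟩
  · refine (LipschitzWith.const P).add ?_
    refine LipschitzWith.of_dist_le_mul fun s t => ?_
    rw [dist_eq_norm, ← sub_smul, norm_smul, dist_eq_norm, mul_comm]; rfl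
  · ext <;> simp [Hmul, w]
  · refine Filter.Eventually.of_forall fun s _ => ?_
    have := ((hasDerivAt_id s).smul_const w).const_add P
    refine hda_congr this ?_ ?_ ?_ <;> simp [w]; ring
  · simp

lemma ae_affine {p : ℝ → Prop} (h : ∀ᵐ s ∂volume, p s) (c : ℝ) :
    ∀ᵐ s ∂(volume : Measure ℝ), p (2 * s + c) := by
  have h1 : Measure.QuasiMeasurePreserving (fun s : ℝ => 2 * s + c) volume volume := by
    refine ⟨by fun_prop, ?_⟩
    have h2 : (fun s : ℝ => 2 * s + c) = (fun s => s + c) ∘ (fun s => 2 * s) := rfl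
    rw [h2, ← Measure.map_map (by fun_prop) (by fun_prop), Real.map_volume_mul_left (by norm_num)]
    rw [Measure.map_smul]
    have : Measure.map (fun s : ℝ => s + c) volume = volume := map_add_right_eq_self volume c
    rw [this]
    exact Measure.smul_absolutelyContinuous
  exact h1.ae h

lemma RS_concat {P M Q : H} {L₁ L₂ : ℝ} (h₁ : L₁ ∈ RS P M) (h₂ : L₂ ∈ RS M Q) :
    L₁ + L₂ ∈ RS P Q := by
  obtain ⟨γ₁, a₁, b₁, K₁, hγ₁, rfl, rfl, hd₁, hi₁, rfl⟩ := h₁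
  obtain ⟨γ₂, a₂, b₂, K₂, hγ₂, h20, rfl, hd₂, hi₂, rfl⟩ := h₂
  let γ : ℝ → H := fun s => γ₁ (min (2 * s) 1) + γ₂ (max (2 * s - 1) 0) - γ₁ 1
  let a : ℝ → ℝ := fun s => if s < 1/2 then 2 * a₁ (2 * s) else 2 * a₂ (2 * s - 1)
  let b : ℝ → ℝ := fun s => if s < 1/2 then 2 * b₁ (2 * s) else 2 * b₂ (2 * s - 1)
  have e1 : ∀ s, s < 1/2 → γ s = γ₁ (2 * s) := by
    intro s hs
    simp only [γ]
    rw [min_eq_left (by linarith), max_eq_right (by linarith), h20]; simp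
  have e2 : ∀ s, 1/2 ≤ s → γ s = γ₂ (2 * s - 1) := by
    intro s hs
    simp only [γ]
    rw [min_eq_right (by linarith), max_eq_left (by linarith)]; simp
  have l2 : LipschitzWith 2 (fun s : ℝ => 2 * s) := by
    refine LipschitzWith.of_dist_le_mul fun s t => ?_
    rw [Real.dist_eq, Real.dist_eq, ← mul_sub, abs_mul]; simp
  have l2' : LipschitzWith 2 (fun s : ℝ => 2 * s - 1) := by
    refine LipschitzWith.of_dist_le_mul fun s t => ?_
    rw [Real.dist_eq, Real.dist_eq, show 2 * s - 1 - (2 * t - 1) = 2 * (s - t) by ring, abs_mul]; simp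
  have sq1 : ∀ s, s < 1/2 → Real.sqrt (a s ^ 2 + b s ^ 2)
      = 2 * Real.sqrt (a₁ (2 * s) ^ 2 + b₁ (2 * s) ^ 2) := by
    intro s hs
    simp only [a, b, if_pos hs]
    rw [show (2 * a₁ (2 * s)) ^ 2 + (2 * b₁ (2 * s)) ^ 2
      = 2 ^ 2 * (a₁ (2 * s) ^ 2 + b₁ (2 * s) ^ 2) by ring,
      Real.sqrt_mul (by positivity), Real.sqrt_sq (by norm_num)]
  have sq2 : ∀ s, 1/2 ≤ s → Real.sqrt (a s ^ 2 + b s ^ 2)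
      = 2 * Real.sqrt (a₂ (2 * s - 1) ^ 2 + b₂ (2 * s - 1) ^ 2) := by
    intro s hs
    simp only [a, b, if_neg (not_lt.2 hs)]
    rw [show (2 * a₂ (2 * s - 1)) ^ 2 + (2 * b₂ (2 * s - 1)) ^ 2
      = 2 ^ 2 * (a₂ (2 * s - 1) ^ 2 + b₂ (2 * s - 1) ^ 2) by ring,
      Real.sqrt_mul (by positivity), Real.sqrt_sq (by norm_num)]
  have j1 : IntervalIntegrable (fun s => 2 * Real.sqrt (a₁ (2 * s) ^ 2 + b₁ (2 * s) ^ 2))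
      volume 0 (1/2) := by
    have := (hi₁.comp_mul_left (c := 2)).const_mul 2
    simpa using this
  have j2 : IntervalIntegrable (fun s => 2 * Real.sqrt (a₂ (2 * s - 1) ^ 2 + b₂ (2 * s - 1) ^ 2))
      volume (1/2) 1 := by
    have := (((hi₂.comp_sub_right 1)).comp_mul_left (c := 2)).const_mul 2
    norm_num at this
    simpa using this
  have hne : ∀ᵐ s ∂(volume : Measure ℝ), s ≠ 1/2 := by
    simp [ae_iff]
  have k1 : Set.EqOn (fun s => 2 * Real.sqrt (a₁ (2 * s) ^ 2 + b₁ (2 * s) ^ 2))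
      (fun s => Real.sqrt (a s ^ 2 + b s ^ 2)) (Set.Ioo 0 (1/2)) := by
    intro s hs; simp only; rw [sq1 s hs.2]
  have ae1 : ∀ᵐ s ∂(volume : Measure ℝ), s ∈ Set.uIoc (0:ℝ) (1/2) →
      2 * Real.sqrt (a₁ (2 * s) ^ 2 + b₁ (2 * s) ^ 2) = Real.sqrt (a s ^ 2 + b s ^ 2) := by
    filter_upwards [hne] with s hs hm
    rw [Set.uIoc_of_le (by norm_num)] at hm
    rw [sq1 s (lt_of_le_of_ne hm.2 hs)]
  have ae2 : ∀ᵐ s ∂(volume : Measure ℝ), s ∈ Set.uIoc (1/2:ℝ) 1 →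
      2 * Real.sqrt (a₂ (2 * s - 1) ^ 2 + b₂ (2 * s - 1) ^ 2) = Real.sqrt (a s ^ 2 + b s ^ 2) := by
    filter_upwards with s hm
    rw [Set.uIoc_of_le (by norm_num)] at hm
    rw [sq2 s hm.1.le]
  have i1 : IntervalIntegrable (fun s => Real.sqrt (a s ^ 2 + b s ^ 2)) volume 0 (1/2) :=
    j1.congr_ae ((ae_restrict_iff' measurableSet_uIoc).2 ae1)
  have i2 : IntervalIntegrable (fun s => Real.sqrt (a s ^ 2 + b s ^ 2)) volume (1/2) 1 :=
    j2.congr_ae ((ae_restrict_iff' measurableSet_uIoc).2 ae2)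
  refine ⟨γ, a, b, (K₁ * 2 + K₂ * 2) + 0, ?_, ?_, ?_, ?_, i1.trans i2, ?_⟩
  · exact ((hγ₁.comp (l2.min_const 1)).add (hγ₂.comp (l2'.max_const 0))).sub (LipschitzWith.const _)
  · rw [e1 0 (by norm_num)]; simp
  · rw [e2 1 (by norm_num)]; norm_num
  · filter_upwards [ae_affine hd₁ 0, ae_affine hd₂ (-1), hne] with s hs1 hs2 hne hm
    rcases lt_or_gt_of_ne hne with hlt | hgt
    · have hd := hs1 ⟨by linarith [hm.1], by linarith⟩
      have hin : HasDerivAt (fun s : ℝ => 2 * s + 0) 2 s := by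
        simpa using ((hasDerivAt_id s).const_mul 2).add_const 0
      have hc := HasDerivAt.scomp s hd hin
      have heq : γ =ᶠ[nhds s] (γ₁ ∘ fun s : ℝ => 2 * s + 0) := by
        filter_upwards [Iio_mem_nhds hlt] with r hr
        rw [e1 r hr]; simp
      have := hc.congr_of_eventuallyEq heq
      refine hda_congr this ?_ ?_ ?_
      · simp only [a, if_pos hlt, add_zero, Prod.smul_mk, smul_eq_mul]
      · simp only [b, if_pos hlt, add_zero, Prod.smul_mk, smul_eq_mul]
      · simp only [e1 s hlt, a, b, if_pos hlt, add_zero, Prod.smul_mk, smul_eq_mul]; ring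
    · have hd := hs2 ⟨by linarith, by linarith [hm.2]⟩
      have hin : HasDerivAt (fun s : ℝ => 2 * s + -1) 2 s := by
        simpa using ((hasDerivAt_id s).const_mul 2).add_const (-1)
      have hc := HasDerivAt.scomp s hd hin
      have heq : γ =ᶠ[nhds s] (γ₂ ∘ fun s : ℝ => 2 * s + -1) := by
        filter_upwards [Ioi_mem_nhds hgt] with r hr
        rw [e2 r (le_of_lt hr)]; simp [sub_eq_add_neg]
      have := hc.congr_of_eventuallyEq heq
      refine hda_congr this ?_ ?_ ?_
      · simp only [a, if_neg (not_lt.2 hgt.le), ← sub_eq_add_neg, Prod.smul_mk, smul_eq_mul]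
      · simp only [b, if_neg (not_lt.2 hgt.le), ← sub_eq_add_neg, Prod.smul_mk, smul_eq_mul]
      · simp only [e2 s hgt.le, a, b, if_neg (not_lt.2 hgt.le), ← sub_eq_add_neg, Prod.smul_mk,
          smul_eq_mul]
        ring
  · rw [← intervalIntegral.integral_add_adjacent_intervals i1 i2]
    rw [← intervalIntegral.integral_congr_ae ae1, ← intervalIntegral.integral_congr_ae ae2]
    rw [intervalIntegral.integral_const_mul, intervalIntegral.integral_const_mul]
    rw [intervalIntegral.integral_comp_mul_left (fun s => Real.sqrt (a₁ s ^ 2 + b₁ s ^ 2)) two_ne_zero]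
    rw [intervalIntegral.integral_comp_mul_sub (fun s => Real.sqrt (a₂ s ^ 2 + b₂ s ^ 2)) two_ne_zero]
    norm_num
    ring


lemma Hmul_assoc (a b c : H) : Hmul (Hmul a b) c = Hmul a (Hmul b c) := by
  simp only [Hmul]; ext <;> simp <;> ring

lemma Hmul_inv_cancel (P Q : H) : Hmul P (Hmul (Hinv P) Q) = Q := by
  simp only [Hmul, Hinv]; ext <;> simp; ring

lemma Hinv_mul_cancel (P Q : H) : Hmul (Hinv P) (Hmul P Q) = Q := by
  simp only [Hmul, Hinv]; ext <;> simp; ring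

lemma Hmul_O (P : H) : Hmul P HO = P := by
  simp only [Hmul, HO]; ext <;> simp

lemma Hdil_one (P : H) : Hdil 1 P = P := by
  simp only [Hdil]; ext <;> simp

lemma RS_T (P : H) (t : ℝ) : 2 * Real.sqrt |t| ∈ RS P (Hmul P (0, 0, t)) := by
  have main : ∀ a b : ℝ, |a| = Real.sqrt |t| / 2 → |b| = Real.sqrt |t| / 2 → -4 * a * b = t →
      2 * Real.sqrt |t| ∈ RS P (Hmul P (0, 0, t)) := by
    intro a b ha hb hab
    have h := RS_concat (RS_concat (RS_concat (RS_seg P a 0) (RS_seg _ 0 b)) (RS_seg _ (-a) 0))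
      (RS_seg _ 0 (-b))
    simp only [ne_eq, OfNat.ofNat_ne_zero, not_false_eq_true, zero_pow, add_zero, zero_add,
      Real.sqrt_sq_eq_abs, abs_neg, ha, hb] at h
    have e1 : Hmul P (0, 0, t) =
        Hmul (Hmul (Hmul (Hmul P (a, 0, 0)) (0, b, 0)) (-a, 0, 0)) (0, -b, 0) := by
      simp only [Hmul]; ext <;> simp
      rw [← hab]; ring
    rw [e1]
    convert h using 1
    ring
  have hs := Real.mul_self_sqrt (abs_nonneg t)
  have hp := Real.sqrt_nonneg |t|
  have hab : |Real.sqrt |t| / 2| = Real.sqrt |t| / 2 := abs_of_nonneg (by positivity)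
  rcases le_total 0 t with h | h
  · refine main (Real.sqrt |t| / 2) (-(Real.sqrt |t| / 2)) hab (by rw [abs_neg, hab]) ?_
    rw [abs_of_nonneg h] at *; nlinarith
  · refine main (Real.sqrt |t| / 2) (Real.sqrt |t| / 2) hab hab ?_
    rw [abs_of_nonpos h] at *; nlinarith

lemma RS_full (P : H) (x y t : ℝ) :
    Real.sqrt (x ^ 2 + y ^ 2) + 2 * Real.sqrt |t| ∈ RS P (Hmul P (x, y, t)) := by
  have h := RS_concat (RS_seg P x y) (RS_T _ t)
  rw [Hmul_assoc] at h
  convert h using 2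
  simp [Hmul]

lemma RS_ne (P Q : H) : (RS P Q).Nonempty := by
  have h := RS_full P (Hmul (Hinv P) Q).1 (Hmul (Hinv P) Q).2.1 (Hmul (Hinv P) Q).2.2
  rw [show ((Hmul (Hinv P) Q).1, (Hmul (Hinv P) Q).2.1, (Hmul (Hinv P) Q).2.2) = Hmul (Hinv P) Q
    from rfl, Hmul_inv_cancel] at h
  exact ⟨_, h⟩

lemma dH_le {P Q : H} {L : ℝ} (h : L ∈ RS P Q) : dH P Q ≤ L := csInf_le (RS_bdd P Q) h

lemma le_dH {P Q : H} {c : ℝ} (h : ∀ L ∈ RS P Q, c ≤ L) : c ≤ dH P Q :=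
  le_csInf (RS_ne P Q) h

lemma dH_nonneg (P Q : H) : 0 ≤ dH P Q := le_dH fun _ h => RS_nonneg h

lemma dH_tri (P M Q : H) : dH P Q ≤ dH P M + dH M Q := by
  have h1 : dH P Q - dH M Q ≤ dH P M := le_dH fun L₁ h₁ => by
    have h2 : dH P Q - L₁ ≤ dH M Q := le_dH fun L₂ h₂ => by
      linarith [dH_le (RS_concat h₁ h₂)]
    linarith
  linarith

lemma dH_shl (R P Q : H) {l : ℝ} (hl : 0 < l) :
    dH (Hmul R (Hdil l P)) (Hmul R (Hdil l Q)) ≤ l * dH P Q := by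
  have : dH (Hmul R (Hdil l P)) (Hmul R (Hdil l Q)) / l ≤ dH P Q := le_dH fun L h => by
    rw [div_le_iff₀ hl, mul_comm]
    exact dH_le (RS_shl h R hl.le)
  rwa [div_le_iff₀ hl, mul_comm] at this

lemma dH_left_le (R P Q : H) : dH (Hmul R P) (Hmul R Q) ≤ dH P Q := by
  simpa [Hdil_one] using dH_shl R P Q one_pos

lemma dH_left (R P Q : H) : dH (Hmul R P) (Hmul R Q) = dH P Q := by
  apply le_antisymm (dH_left_le R P Q)
  have := dH_left_le (Hinv R) (Hmul R P) (Hmul R Q)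
  rwa [Hinv_mul_cancel, Hinv_mul_cancel] at this

lemma dH_dil (q : H) {l : ℝ} (hl : 0 < l) : dH HO (Hdil l q) ≤ l * dH HO q := by
  have := dH_shl HO HO q hl
  convert this using 2 <;> simp [Hmul, HO, Hdil]

lemma dH_O (P q : H) : dH P (Hmul P q) = dH HO q := by
  have := dH_left P HO q
  rwa [Hmul_O] at this

lemma dH_O' (P Q : H) : dH P Q = dH HO (Hmul (Hinv P) Q) := by
  rw [← dH_O P, Hmul_inv_cancel]

def pr (P : H) : ℂ := ⟨P.1, P.2.1⟩
def hz (v : ℂ) : H := (v.re, v.im, 0)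

lemma norm_sqrt (v : ℂ) : ‖v‖ = Real.sqrt (v.re ^ 2 + v.im ^ 2) := by
  rw [Complex.norm_def, Complex.normSq_apply]; congr 1; ring

lemma pr_mul (P Q : H) : pr (Hmul P Q) = pr P + pr Q := by
  apply Complex.ext <;> simp [pr, Hmul]

lemma pr_hz (v : ℂ) : pr (hz v) = v := rfl

lemma dH_hor (P Q : H) : ‖pr Q - pr P‖ ≤ dH P Q := le_dH fun L h => by
  rw [norm_sqrt]; exact RS_hor h

lemma dH_vertO (q : H) : |q.2.2| ≤ 2 * dH HO q ^ 2 := by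
  have h : Real.sqrt (|q.2.2| / 2) ≤ dH HO q := le_dH fun L h => by
    apply Real.sqrt_le_iff.2 ⟨RS_nonneg h, ?_⟩
    linarith [RS_vert h]
  have := (Real.sqrt_le_iff.1 h).2
  linarith

lemma dH_full (P : H) (x y t : ℝ) :
    dH P (Hmul P (x, y, t)) ≤ Real.sqrt (x ^ 2 + y ^ 2) + 2 * Real.sqrt |t| := dH_le (RS_full P x y t)

lemma dH_seg (P : H) (v : ℂ) : dH P (Hmul P (hz v)) ≤ ‖v‖ := by
  rw [norm_sqrt]; exact dH_le (RS_seg P v.re v.im)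

lemma dH_hz (P : H) (v : ℂ) : dH P (Hmul P (hz v)) = ‖v‖ := by
  apply le_antisymm (dH_seg P v)
  have := dH_hor P (Hmul P (hz v))
  rwa [pr_mul, pr_hz, add_sub_cancel_left] at this

lemma dH_pert (q : H) (s D : ℝ) (hD : 0 < D) (h1 : D ≤ dH HO q) (h2 : dH HO q ≤ 2 * D)
    (hs : |s| < D ^ 2 / 16) : dH HO (Hmul q (0, 0, s)) ≤ dH HO q + 64 * |s| / D := by
  set N := ‖pr q‖ with hN
  have hN0 : 0 ≤ N := norm_nonneg _
  have hNsq : N ^ 2 = q.1 ^ 2 + q.2.1 ^ 2 := by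
    rw [hN, norm_sqrt, Real.sq_sqrt (by positivity)]; rfl
  rcases le_or_gt (D / 2) N with hc | hc
  · have hNp : 0 < N := by linarith
    let c := s / (4 * N ^ 2)
    let v : ℂ := ⟨-c * q.2.1, c * q.1⟩
    have hv : ‖v‖ = |s| / (4 * N) := by
      rw [norm_sqrt]
      have : v.re ^ 2 + v.im ^ 2 = (s / (4 * N)) ^ 2 := by
        have : v.re ^ 2 + v.im ^ 2 = c ^ 2 * (q.1 ^ 2 + q.2.1 ^ 2) := by simp only [v]; ring
        rw [this, ← hNsq]; simp only [c]; field_simp; try ring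
      rw [this, Real.sqrt_sq_eq_abs, abs_div, abs_of_pos (by positivity : 0 < 4 * N)]
    have e : Hmul q (0, 0, s) = Hmul (Hmul (hz v) q) (hz (-v)) := by
      have : s = 4 * c * (q.1 ^ 2 + q.2.1 ^ 2) := by
        rw [← hNsq]; simp only [c]; field_simp
      simp only [Hmul, hz, v]; ext <;> simp
      rw [this]; ring
    rw [e]
    have t1 := dH_tri HO (Hmul (hz v) q) (Hmul (Hmul (hz v) q) (hz (-v)))
    have t2 := dH_tri HO (hz v) (Hmul (hz v) q)
    have t3 := dH_hz HO v
    rw [show Hmul HO (hz v) = hz v by simp [Hmul, HO, hz]] at t3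
    rw [dH_O] at t2
    rw [dH_hz, norm_neg] at t1
    have : |s| / (4 * N) ≤ |s| / D := by
      apply div_le_div_of_nonneg_left (abs_nonneg s) hD; linarith
    have h64 : 64 * |s| / D = 64 * (|s| / D) := by ring
    have : 0 ≤ |s| / D := by positivity
    rw [h64]; linarith
  · have hq := dH_full HO q.1 q.2.1 q.2.2
    rw [show Hmul HO (q.1, q.2.1, q.2.2) = q by simp [Hmul, HO]] at hq
    have hNs : Real.sqrt (q.1 ^ 2 + q.2.1 ^ 2) = N := by rw [← hNsq, Real.sqrt_sq hN0]
    rw [hNs] at hq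
    have ht1 : D / 4 ≤ Real.sqrt |q.2.2| := by linarith
    have ht : D ^ 2 / 16 ≤ |q.2.2| := by
      have := Real.sq_sqrt (abs_nonneg q.2.2)
      nlinarith
    have htp : 0 < |q.2.2| := lt_of_lt_of_le (by positivity) ht
    have ht0 : q.2.2 ≠ 0 := abs_pos.1 htp
    set r := s / q.2.2 with hr
    have hra : |r| ≤ 16 * |s| / D ^ 2 := by
      rw [hr, abs_div, div_le_div_iff₀ htp (by positivity)]
      nlinarith [abs_nonneg s]
    have hr1 : |r| < 1 := by
      rw [hr, abs_div, div_lt_one htp]; linarith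
    have hr1' := abs_lt.1 hr1
    set l := Real.sqrt (1 + r) with hl
    have hlp : 0 < l := Real.sqrt_pos.2 (by linarith)
    have hlsq : l ^ 2 = 1 + r := Real.sq_sqrt (by linarith)
    have hl1 : |1 - l| ≤ |r| := by
      have : |r| = |1 - l| * (1 + l) := by
        rw [← abs_of_pos (by linarith : 0 < 1 + l), ← abs_mul, ← abs_neg r]; congr 1; nlinarith
      rw [this]; nlinarith [abs_nonneg (1 - l)]
    have e : Hmul q (0, 0, s) = Hmul (Hdil l q) (hz ((1 - l : ℝ) * pr q)) := by
      simp only [Hmul, Hdil, hz, pr]; ext <;> simp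
      · ring
      · ring
      · rw [hlsq, hr]; field_simp; ring
    rw [e]
    have t1 := dH_tri HO (Hdil l q) (Hmul (Hdil l q) (hz ((1 - l : ℝ) * pr q)))
    rw [dH_hz, norm_mul, Complex.norm_real, Real.norm_eq_abs, ← hN] at t1
    have t2 := dH_dil q hlp
    have hle : l ≤ 1 + |1 - l| := by linarith [neg_abs_le (1 - l)]
    have hd0 := dH_nonneg HO q
    have t3 : l * dH HO q ≤ dH HO q + |1 - l| * dH HO q := by nlinarith
    have t4 : |1 - l| * N ≤ |1 - l| * (2 * D) :=
      mul_le_mul_of_nonneg_left (by linarith) (abs_nonneg _)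
    have t5 : |1 - l| * dH HO q ≤ |1 - l| * (2 * D) :=
      mul_le_mul_of_nonneg_left h2 (abs_nonneg _)
    have t6 : |1 - l| * (2 * D) ≤ (16 * |s| / D ^ 2) * (2 * D) :=
      mul_le_mul_of_nonneg_right (hl1.trans hra) (by positivity)
    have t7 : (16 * |s| / D ^ 2) * (2 * D) = 32 * |s| / D := by field_simp; ring
    have t8 : 64 * |s| / D = 32 * |s| / D + 32 * |s| / D := by ring
    linarith

def Dl (f : H → H) (P : H) (v : ℂ) : ℂ := pr (f (Hmul P (hz v))) - pr (f P)

lemma hz_add (P : H) (v : ℂ) (s s' : ℝ) :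
    Hmul (Hmul P (hz (s * v))) (hz (s' * v)) = Hmul P (hz ((s + s' : ℝ) * v)) := by
  simp only [Hmul, hz]; ext <;> simp <;> ring

lemma Dl_add (f : H → H) (P : H) (v : ℂ) (s s' : ℝ) :
    Dl f P ((s + s' : ℝ) * v) = Dl f P (s * v) + Dl f (Hmul P (hz (s * v))) (s' * v) := by
  simp only [Dl, hz_add]; ring

lemma Dl_upper {f : H → H} {ε : ℝ} (hf : IsBiLip ε f) (P : H) (v : ℂ) :
    ‖Dl f P v‖ ≤ (1 + ε) * ‖v‖ := by
  have h1 := (hf P (Hmul P (hz v))).2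
  rw [dH_hz] at h1
  exact (dH_hor _ _).trans h1

lemma Dl_lower {f : H → H} {τ : ℝ} (hτ : 0 < τ) (hτ1 : τ ^ 4 ≤ 1 / 100) (hf : IsBiLip (τ ^ 8) f)
    (P : H) (v : ℂ) : (1 - 200 * τ ^ 4) * ‖v‖ ≤ ‖Dl f P v‖ := by
  rcases eq_or_ne v 0 with rfl | hv
  · simp
  set ℓ := ‖v‖ with hℓ
  have hℓp : 0 < ℓ := norm_pos_iff.2 hv
  set e := τ ^ 4 with he
  have hep : 0 < e := by positivity
  have hε : τ ^ 8 = e ^ 2 := by rw [he]; ring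
  rw [hε] at hf
  set m := 1 / e with hm
  have hem : e * m = 1 := by rw [hm]; field_simp
  have hm100 : 100 ≤ m := by rw [hm, le_div_iff₀ hep]; linarith
  have hε1 : e ^ 2 ≤ 1 / 10000 := by nlinarith
  set P1 := Hmul P (hz v) with hP1
  set P2 := Hmul P1 (hz ((m : ℂ) * v)) with hP2
  have hP2' : P2 = Hmul P (hz ((1 + m : ℝ) * v)) := by
    have := hz_add P v 1 m
    rw [hP2, hP1, ← this]; simp
  have d1 := hf P P1
  rw [hP1, dH_hz, ← hP1] at d1
  have d2 := hf P1 P2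
  rw [hP2, dH_hz, ← hP2, norm_mul, Complex.norm_real, Real.norm_eq_abs, abs_of_pos (by linarith)] at d2
  have d3 := (hf P P2).1
  rw [hP2', dH_hz, ← hP2', norm_mul, Complex.norm_real, Real.norm_eq_abs,
    abs_of_pos (by linarith)] at d3
  rw [← hℓ] at d1 d2 d3
  set q1 := Hmul (Hinv (f P)) (f P1) with hq1
  set qJ := Hmul (Hinv (f P1)) (f P2) with hqJ
  rw [dH_O' (f P) (f P1), ← hq1] at d1
  rw [dH_O' (f P1) (f P2), ← hqJ] at d2
  have hprod : f P2 = Hmul (f P) (Hmul (hz (pr q1)) (Hmul qJ (0, 0, q1.2.2))) := by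
    rw [← Hmul_inv_cancel (f P1) (f P2), ← hqJ]
    conv_lhs => rw [← Hmul_inv_cancel (f P) (f P1), ← hq1]
    simp only [Hmul, hz, pr]; ext <;> simp <;> ring
  have hpr : Dl f P v = pr q1 := by
    rw [hq1, pr_mul]; simp only [Dl, ← hP1]
    apply Complex.ext <;> simp [pr, Hinv] <;> ring
  rw [hprod, dH_O] at d3
  have t1 := dH_tri HO (hz (pr q1)) (Hmul (hz (pr q1)) (Hmul qJ (0, 0, q1.2.2)))
  rw [dH_O] at t1
  have t0 := dH_hz HO (pr q1)
  rw [show Hmul HO (hz (pr q1)) = hz (pr q1) by simp [Hmul, HO, hz]] at t0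
  have hinv : 1 - e ^ 2 ≤ (1 + e ^ 2)⁻¹ := by
    rw [le_inv_comm₀ (by linarith) (by positivity), ← one_div, le_div_iff₀ (by linarith)]
    nlinarith [sq_nonneg (e ^ 2)]
  have hml : 0 < m * ℓ := by positivity
  set D := (1 - e ^ 2) * (m * ℓ) with hD
  have hDle : D ≤ dH HO qJ := (mul_le_mul_of_nonneg_right hinv hml.le).trans d2.1
  have hD9 : 0.99 * (m * ℓ) ≤ D := by
    have hem2 : e ^ 2 * (m * ℓ) ≤ 1 / 10000 * (m * ℓ) := mul_le_mul_of_nonneg_right hε1 hml.le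
    rw [hD]; linarith
  have hDp : 0 < D := by linarith
  have hem2 : e ^ 2 * (m * ℓ) ≤ 1 / 10000 * (m * ℓ) := mul_le_mul_of_nonneg_right hε1 hml.le
  have hD2 : dH HO qJ ≤ 2 * D := by linarith [d2.2]
  have ht : |q1.2.2| ≤ 3 * ℓ ^ 2 := by
    have h := dH_vertO q1
    have h0 := dH_nonneg HO q1
    have h3 : e ^ 2 * ℓ ≤ 1 / 10000 * ℓ := mul_le_mul_of_nonneg_right hε1 hℓp.le
    have h1 : dH HO q1 ≤ 1.0001 * ℓ := by linarith [d1.2]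
    have h2 : dH HO q1 ^ 2 ≤ (1.0001 * ℓ) ^ 2 := pow_le_pow_left₀ h0 h1 2
    nlinarith
  have hts : |q1.2.2| < D ^ 2 / 16 := by
    have h3 : 100 * ℓ ≤ m * ℓ := mul_le_mul_of_nonneg_right hm100 hℓp.le
    have h1 : 99 * ℓ ≤ D := by linarith
    have h2 : (99 * ℓ) ^ 2 ≤ D ^ 2 := pow_le_pow_left₀ (by positivity) h1 2
    nlinarith
  have t2 := dH_pert qJ q1.2.2 D hDp hDle hD2 hts
  have t3 : 64 * |q1.2.2| / D ≤ 194 * e * ℓ := by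
    rw [div_le_iff₀ hDp]
    have : 194 * e * ℓ * (0.99 * (m * ℓ)) ≤ 194 * e * ℓ * D :=
      mul_le_mul_of_nonneg_left hD9 (by positivity)
    have h2 : 194 * e * ℓ * (0.99 * (m * ℓ)) = 194 * 0.99 * ℓ ^ 2 := by
      linear_combination (194 * 0.99 * ℓ ^ 2) * hem
    linarith [sq_nonneg ℓ]
  have t4 : (1 - e ^ 2) * ((1 + m) * ℓ) ≤ (1 + e ^ 2)⁻¹ * ((1 + m) * ℓ) :=
    mul_le_mul_of_nonneg_right hinv (by positivity)
  have t5 : (1 - e ^ 2) * ((1 + m) * ℓ) - (1 + e ^ 2) * (m * ℓ) = ℓ - e ^ 2 * ℓ - 2 * e * ℓ := by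
    linear_combination (-2 * e * ℓ) * hem
  have t6 : e ^ 2 * ℓ ≤ e * ℓ := mul_le_mul_of_nonneg_right (by nlinarith) hℓp.le
  rw [hpr]
  rw [t0] at t1
  have d22 := d2.2
  clear_value e m D P1 P2 q1 qJ
  linarith [mul_pos hep hℓp]


def ip (z w : ℂ) : ℝ := z.re * w.re + z.im * w.im

lemma nsq (z : ℂ) : ‖z‖ ^ 2 = z.re ^ 2 + z.im ^ 2 := by
  rw [norm_sqrt, Real.sq_sqrt (by positivity)]

lemma ip_le (z w : ℂ) : ip z w ≤ ‖z‖ * ‖w‖ := by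
  apply le_of_abs_le
  apply abs_le_of_sq_le_sq _ (by positivity)
  rw [mul_pow, nsq, nsq, ip]
  nlinarith [sq_nonneg (z.re * w.im - z.im * w.re)]

lemma nsq_sub (z w : ℂ) : ‖z - w‖ ^ 2 = ‖z‖ ^ 2 + ‖w‖ ^ 2 - 2 * ip z w := by
  rw [nsq, nsq, nsq, ip, Complex.sub_re, Complex.sub_im]; ring

lemma nsq_add (z w : ℂ) : ‖z + w‖ ^ 2 = ‖z‖ ^ 2 + ‖w‖ ^ 2 + 2 * ip z w := by
  rw [nsq, nsq, nsq, ip, Complex.add_re, Complex.add_im]; ring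

lemma col_vec (A B : ℂ) (L l E δ : ℝ) (hl : 0 < l) (hL : l ≤ L) (hE : E ≤ 1.1) (hE0 : 0 ≤ E)
    (hδ : δ ≤ 1) (hA : ‖A‖ ≤ E * L) (hA' : (E - δ) * L ≤ ‖A‖) (hB : ‖B‖ ≤ E * l)
    (hr : ‖A - B‖ ≤ E * (L - l)) : ‖B / l - A / L‖ ^ 2 ≤ 4 * δ * (L / l) := by
  have hLp : 0 < L := by linarith
  set u := A / L with hu
  set D := B / l with hD
  have L0 : (L : ℂ) ≠ 0 := by exact_mod_cast hLp.ne'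
  have l0 : (l : ℂ) ≠ 0 := by exact_mod_cast hl.ne'
  have eA : A = L * u := by rw [hu]; field_simp
  have eB : B = l * D := by rw [hD]; field_simp
  have hn : ‖A‖ = L * ‖u‖ := by rw [eA]; simp [abs_of_pos hLp]
  have hm : ‖B‖ = l * ‖D‖ := by rw [eB]; simp [abs_of_pos hl]
  set k := L / l with hk
  have hkl : L = k * l := by rw [hk]; field_simp
  have hk1 : 1 ≤ k := by rw [hk, le_div_iff₀ hl]; linarith
  have n0 := norm_nonneg u
  have n1 : ‖u‖ ≤ E := by rw [hn] at hA; nlinarith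
  have n2 : E - δ ≤ ‖u‖ := by
    rw [hn] at hA'; nlinarith
  have m1 : ‖D‖ ≤ E := by rw [hm] at hB; nlinarith
  have m0 := norm_nonneg D
  have h1 := ip_le u (A - B)
  have h2 : ip u (A - B) = L * ‖u‖ ^ 2 - l * ip D u := by
    rw [nsq, show A - B = L * u - l * D by rw [← eA, ← eB]]; simp [ip]; ring
  have h3 : ‖u‖ * ‖A - B‖ ≤ ‖u‖ * (E * (L - l)) := mul_le_mul_of_nonneg_left hr n0
  have h4 : k * ‖u‖ ^ 2 - ip D u ≤ ‖u‖ * (E * (k - 1)) := by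
    have : l * (k * ‖u‖ ^ 2 - ip D u) ≤ l * (‖u‖ * (E * (k - 1))) := by
      rw [h2, hkl] at h1; rw [hkl] at h3; nlinarith
    exact le_of_mul_le_mul_left this hl
  rw [nsq_sub]
  have h5 : ‖D‖ ^ 2 ≤ E ^ 2 := pow_le_pow_left₀ m0 m1 2
  set d := E - ‖u‖ with hd
  have hd0 : 0 ≤ d := by linarith
  have hdδ : d ≤ δ := by linarith
  have h6 : d ^ 2 + 2 * k * ‖u‖ * d ≤ 4 * δ * k := by
    have a1 : d ^ 2 ≤ δ * k := by nlinarith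
    have a2 : ‖u‖ * d ≤ 1.1 * δ := by nlinarith
    have a3 : k * (‖u‖ * d) ≤ k * (1.1 * δ) := mul_le_mul_of_nonneg_left a2 (by linarith)
    have a4 : 0 ≤ k * δ := mul_nonneg (by linarith) (by linarith)
    nlinarith
  have h7 : d ^ 2 + 2 * k * ‖u‖ * d = E ^ 2 + ‖u‖ ^ 2 + 2 * (‖u‖ * (E * (k - 1))) - 2 * k * ‖u‖ ^ 2 := by
    rw [hd]; ring
  linarith

structure Good (f : H → H) (τ : ℝ) : Prop where
  pos : 0 < τ
  small : τ ≤ 1 / 1000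
  bl : IsBiLip (τ ^ 8) f

lemma Good.t4 {f : H → H} {τ : ℝ} (h : Good f τ) : τ ^ 4 ≤ τ / 10 ^ 9 := by
  have : τ ^ 3 ≤ (1 / 1000) ^ 3 := pow_le_pow_left₀ h.pos.le h.small 3
  have := mul_le_mul_of_nonneg_right this h.pos.le
  calc τ ^ 4 = τ ^ 3 * τ := by ring
    _ ≤ _ := this
    _ = _ := by norm_num; ring

lemma Good.t8 {f : H → H} {τ : ℝ} (h : Good f τ) : τ ^ 8 ≤ τ ^ 4 / 1000 := by
  have h4 := h.t4
  have := h.small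
  have h0 := pow_pos h.pos 4
  have : τ ^ 8 = τ ^ 4 * τ ^ 4 := by ring
  rw [this]; nlinarith

lemma Good.t2 {f : H → H} {τ : ℝ} (h : Good f τ) : τ ^ 2 ≤ τ / 1000 := by
  have := h.small
  have h0 := h.pos
  nlinarith

def F (f : H → H) (v : ℂ) (R : ℝ) (P : H) : ℂ := Dl f P ((R : ℂ) * v) / (R : ℂ)

lemma Dl_le {f : H → H} {τ : ℝ} (h : Good f τ) {v : ℂ} (hv : ‖v‖ = 1) {s : ℝ} (hs : 0 ≤ s) (P : H) :
    ‖Dl f P (s * v)‖ ≤ (1 + τ ^ 8) * s := by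
  have := Dl_upper h.bl P (s * v)
  rwa [norm_mul, hv, mul_one, Complex.norm_real, Real.norm_eq_abs, abs_of_nonneg hs] at this

lemma Dl_ge {f : H → H} {τ : ℝ} (h : Good f τ) {v : ℂ} (hv : ‖v‖ = 1) {s : ℝ} (hs : 0 ≤ s) (P : H) :
    (1 - 200 * τ ^ 4) * s ≤ ‖Dl f P (s * v)‖ := by
  have := Dl_lower h.pos (by linarith [h.t4, h.small]) h.bl P (s * v)
  rwa [norm_mul, hv, mul_one, Complex.norm_real, Real.norm_eq_abs, abs_of_nonneg hs] at this

lemma F_norm (f : H → H) (v : ℂ) {R : ℝ} (hR : 0 < R) (P : H) :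
    ‖F f v R P‖ = ‖Dl f P (R * v)‖ / R := by
  rw [F, norm_div, Complex.norm_real, Real.norm_eq_abs, abs_of_pos hR]

lemma F_le {f : H → H} {τ : ℝ} (h : Good f τ) {v : ℂ} (hv : ‖v‖ = 1) {R : ℝ} (hR : 0 < R) (P : H) :
    ‖F f v R P‖ ≤ 1 + τ ^ 8 := by
  rw [F_norm f v hR, div_le_iff₀ hR]; exact Dl_le h hv hR.le P

lemma F_ge {f : H → H} {τ : ℝ} (h : Good f τ) {v : ℂ} (hv : ‖v‖ = 1) {R : ℝ} (hR : 0 < R) (P : H) :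
    1 - 200 * τ ^ 4 ≤ ‖F f v R P‖ := by
  rw [F_norm f v hR, le_div_iff₀ hR]; exact Dl_ge h hv hR.le P

lemma col {f : H → H} {τ : ℝ} (h : Good f τ) {v : ℂ} (hv : ‖v‖ = 1) {α l L κ : ℝ} (hα : 0 ≤ α)
    (hl : 0 < l) (hL : α + l ≤ L) (hκ : 0 ≤ κ) (hκL : L ≤ κ ^ 2 * l) (P : H) :
    ‖F f v l (Hmul P (hz (α * v))) - F f v L P‖ ≤ 29 * τ ^ 2 * κ := by
  have t8 := h.t8
  have t4 := h.t4
  have ts := h.small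
  have tp := h.pos
  have t40 : 0 < τ ^ 4 := by positivity
  have t80 : 0 < τ ^ 8 := by positivity
  have e1 := Dl_add f P v α (l + (L - α - l))
  have e2 := Dl_add f (Hmul P (hz (α * v))) v l (L - α - l)
  rw [e2] at e1
  rw [show α + (l + (L - α - l)) = L by ring] at e1
  have b1 := Dl_le h hv hα P
  have b3 := Dl_le h hv (by linarith : 0 ≤ L - α - l) (Hmul (Hmul P (hz (α * v))) (hz (l * v)))
  have key := col_vec (Dl f P (L * v)) (Dl f (Hmul P (hz (α * v))) (l * v)) L l (1 + τ ^ 8)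
    (201 * τ ^ 4) hl (by linarith) (by linarith) (by linarith) (by linarith)
    (Dl_le h hv (by linarith) P)
    (le_trans (mul_le_mul_of_nonneg_right (by linarith) (by linarith)) (Dl_ge h hv (by linarith) P))
    (Dl_le h hv hl.le _) (by
      rw [e1]
      refine le_trans (le_of_eq ?_) ((norm_add_le (Dl f P (α * v))
        (Dl f (Hmul (Hmul P (hz (α * v))) (hz (l * v))) ((L - α - l : ℝ) * v))).trans ?_)
      · congr 1; ring
      · linarith)
  refine le_of_abs_le (abs_le_of_sq_le_sq ?_ (by positivity))
  refine key.trans ?_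
  have : L / l ≤ κ ^ 2 := by rw [div_le_iff₀ hl]; exact hκL
  have := mul_le_mul_of_nonneg_left this t40.le
  have h2 : 0 ≤ τ ^ 4 * κ ^ 2 := by positivity
  calc 4 * (201 * τ ^ 4) * (L / l) = 804 * (τ ^ 4 * (L / l)) := by ring
    _ ≤ 841 * (τ ^ 4 * κ ^ 2) := by linarith
    _ = _ := by ring

lemma hz_zero (P : H) (v : ℂ) : Hmul P (hz ((0 : ℝ) * v)) = P := by
  simp [Hmul, hz]

lemma F_line0 {f : H → H} {τ : ℝ} (h : Good f τ) {v : ℂ} (hv : ‖v‖ = 1) {R s : ℝ} (hR : 0 < R)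
    (hs : 0 ≤ s) (hs2 : s ≤ 2 * R) (P : H) :
    ‖F f v R (Hmul P (hz (s * v))) - F f v R P‖ ≤ τ := by
  have c1 := col h hv hs hR (by linarith : s + R ≤ 3 * R) zero_le_two (by linarith) P
  have c2 := col h hv le_rfl hR (by linarith : 0 + R ≤ 3 * R) zero_le_two (by linarith) P
  rw [hz_zero, norm_sub_rev] at c2
  have := norm_sub_le_norm_sub_add_norm_sub (F f v R (Hmul P (hz (s * v)))) (F f v (3 * R) P) (F f v R P)
  linarith [h.t2, h.pos]

lemma F_line {f : H → H} {τ : ℝ} (h : Good f τ) {v : ℂ} (hv : ‖v‖ = 1) {R s : ℝ} (hR : 0 < R)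
    (hs2 : |s| ≤ 2 * R) (P : H) :
    ‖F f v R (Hmul P (hz (s * v))) - F f v R P‖ ≤ τ := by
  rcases le_total 0 s with hs | hs
  · exact F_line0 h hv hR hs (by rwa [abs_of_nonneg hs] at hs2) P
  · have := F_line0 h hv hR (by linarith : 0 ≤ -s) (by rwa [abs_of_nonpos hs] at hs2)
      (Hmul P (hz (s * v)))
    rw [hz_add, add_neg_cancel, hz_zero] at this
    rwa [norm_sub_rev]

lemma F_scale {f : H → H} {τ : ℝ} (h : Good f τ) {v : ℂ} (hv : ‖v‖ = 1) {R r : ℝ} (hR : 0 < R)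
    (h1 : τ ^ 2 * R / 2 ≤ r) (h2 : r ≤ τ ^ 2 * R) (P : H) :
    ‖F f v r P - F f v R P‖ ≤ 44 * τ := by
  have tp := h.pos
  have ts := h.small
  have hrp : 0 < r := lt_of_lt_of_le (by positivity) h1
  have h3 := h.t2
  have c := col h hv le_rfl hrp (by nlinarith : 0 + r ≤ R) (by positivity : 0 ≤ 1.5 / τ) (by
    rw [div_pow, div_mul_eq_mul_div, le_div_iff₀ (by positivity)]
    nlinarith) P
  rw [hz_zero] at c
  refine c.trans ?_
  have : 29 * τ ^ 2 * (1.5 / τ) = 43.5 * τ := by field_simp; norm_num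
  rw [this]; linarith

lemma pr_lip {f : H → H} {τ : ℝ} (h : Good f τ) (P q : H) :
    ‖pr (f (Hmul P q)) - pr (f P)‖ ≤ (1 + τ ^ 8) * (‖pr q‖ + 2 * Real.sqrt |q.2.2|) := by
  have h1 := dH_hor (f P) (f (Hmul P q))
  have h2 := (h.bl P (Hmul P q)).2
  have h3 := dH_full P q.1 q.2.1 q.2.2
  rw [show Real.sqrt (q.1 ^ 2 + q.2.1 ^ 2) = ‖pr q‖ by rw [norm_sqrt]; rfl] at h3
  have := mul_le_mul_of_nonneg_left h3 (by have := pow_pos h.pos 8; linarith : 0 ≤ 1 + τ ^ 8)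
  exact h1.trans (h2.trans this)

lemma F_trans {f : H → H} {τ : ℝ} (h : Good f τ) {v : ℂ} (hv : ‖v‖ = 1) {R : ℝ} (hR : 0 < R)
    (w : ℂ) (hw : ‖w‖ ≤ τ ^ 2 * R) (P : H) :
    ‖F f v R (Hmul P (hz w)) - F f v R P‖ ≤ 7 * τ := by
  have tp := h.pos
  have ts := h.small
  have t2 := h.t2
  have t8 := h.t8
  have t4 := h.t4
  have t80 : 0 < τ ^ 8 := by positivity
  set c := 4 * R * (v.re * w.im - v.im * w.re) with hc
  have e : Hmul (Hmul P (hz w)) (hz (R * v)) = Hmul (Hmul P (hz (R * v))) (w.re, w.im, c) := by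
    simp only [Hmul, hz, hc]; ext <;> simp <;> ring
  have a1 := pr_lip h P (hz w)
  have a2 := pr_lip h (Hmul P (hz (R * v))) (w.re, w.im, c)
  rw [← e] at a2
  have hcb : |c| ≤ 4 * R * (τ ^ 2 * R) := by
    have : |v.re * w.im - v.im * w.re| ≤ ‖w‖ := by
      apply abs_le_of_sq_le_sq _ (norm_nonneg _)
      have := nsq v
      rw [hv] at this
      have e : ‖w‖ ^ 2 = (v.re ^ 2 + v.im ^ 2) * ‖w‖ ^ 2 := by rw [← this]; ring
      rw [e, nsq]
      nlinarith [sq_nonneg (v.re * w.re + v.im * w.im)]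
    rw [hc, abs_mul, abs_of_pos (by positivity : 0 < 4 * R)]
    exact mul_le_mul_of_nonneg_left (this.trans hw) (by positivity)
  have hsq : Real.sqrt |c| ≤ 2 * (τ * R) := by
    apply Real.sqrt_le_iff.2 ⟨by positivity, ?_⟩
    nlinarith
  simp only [pr_hz] at a1
  have e0 : (hz w).2.2 = 0 := rfl
  rw [e0, abs_zero, Real.sqrt_zero] at a1
  have e3 : pr ((w.re, w.im, c) : H) = w := rfl
  simp only [e3] at a2
  have e4 : F f v R (Hmul P (hz w)) - F f v R P = ((pr (f (Hmul (Hmul P (hz w)) (hz (R * v)))) -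
      pr (f (Hmul P (hz (R * v))))) - (pr (f (Hmul P (hz w))) - pr (f P))) / (R : ℂ) := by
    simp only [F, Dl]; ring
  rw [e4, norm_div, Complex.norm_real, Real.norm_eq_abs, abs_of_pos hR, div_le_iff₀ hR]
  refine (norm_sub_le _ _).trans ?_
  have b1 : (1 + τ ^ 8) * (‖w‖ + 2 * Real.sqrt |c|) ≤ (1 + τ ^ 8) * (4.1 * (τ * R)) := by
    apply mul_le_mul_of_nonneg_left _ (by linarith)
    nlinarith
  have b2 : (1 + τ ^ 8) * (‖w‖ + 2 * 0) ≤ (1 + τ ^ 8) * (0.1 * (τ * R)) := by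
    apply mul_le_mul_of_nonneg_left _ (by linarith)
    nlinarith
  have b3 : (1 + τ ^ 8) * (τ * R) ≤ 1.1 * (τ * R) :=
    mul_le_mul_of_nonneg_right (by linarith) (by positivity)
  nlinarith [mul_pos tp hR]


lemma Good.E1 {f : H → H} {τ : ℝ} (h : Good f τ) : (1 + τ ^ 8) ^ 2 ≤ 1 + τ := by
  have t8 := h.t8
  have t4 := h.t4
  have tp := h.pos
  have ts := h.small
  have t80 : 0 < τ ^ 8 := by have := h.pos; positivity
  have : τ ^ 8 ≤ τ / 100 := by linarith
  nlinarith

lemma Good.E2 {f : H → H} {τ : ℝ} (h : Good f τ) : 1 - τ ≤ (1 - 200 * τ ^ 4) ^ 2 := by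
  have t4 := h.t4
  have tp := h.pos
  have : 200 * τ ^ 4 ≤ τ / 2 := by linarith
  nlinarith [sq_nonneg (200 * τ ^ 4)]

lemma hz_half (P : H) (r : ℝ) : Hmul P (hz ((r : ℂ) * (1 + Complex.I))) =
    Hmul (Hmul (Hmul P (hz ((r / 2 : ℝ) * 1))) (hz (r * Complex.I))) (hz ((r / 2 : ℝ) * 1)) := by
  simp only [Hmul, hz]; ext <;> simp <;> ring

lemma F_perp {f : H → H} {τ : ℝ} (h : Good f τ) {R : ℝ} (hR : 0 < R) (P : H) :
    |ip (F f 1 R P) (F f Complex.I R P)| ≤ 200 * τ := by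
  have tp := h.pos
  have ts := h.small
  have t2 := h.t2
  have t8 := h.t8
  have t4 := h.t4
  have t40 : 0 < τ ^ 4 := by positivity
  have t80 : 0 < τ ^ 8 := by positivity
  have hI : ‖Complex.I‖ = 1 := by simp
  have h1 : ‖(1:ℂ)‖ = 1 := by simp
  set a := F f 1 R P with ha
  set b := F f Complex.I R P with hb
  set r := τ ^ 2 * R with hr
  have hrp : 0 < r := by positivity
  have rc : (r : ℂ) ≠ 0 := by exact_mod_cast hrp.ne'
  set Q1 := Hmul P (hz ((r / 2 : ℝ) * 1)) with hQ1
  set Q2 := Hmul Q1 (hz (r * Complex.I)) with hQ2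
  have e : Dl f P ((r : ℂ) * (1 + Complex.I)) / r =
      F f 1 (r / 2) P / 2 + F f Complex.I r Q1 + F f 1 (r / 2) Q2 / 2 := by
    simp only [F, Dl, hz_half, ← hQ1, ← hQ2]
    push_cast
    field_simp
    ring
  set W := Dl f P ((r : ℂ) * (1 + Complex.I)) / r with hW
  have s1 := F_scale h h1 hR (r := r / 2) le_rfl (by linarith) P
  have s2 := F_scale h hI hR (r := r) (by linarith) le_rfl Q1
  have s3 := F_scale h h1 hR (r := r / 2) le_rfl (by linarith) Q2
  have nr : ‖((r / 2 : ℝ) : ℂ) * 1‖ ≤ τ ^ 2 * R := by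
    rw [mul_one, Complex.norm_real, Real.norm_eq_abs, abs_of_pos (by positivity)]; linarith
  have nI : ‖(r : ℂ) * Complex.I‖ ≤ τ ^ 2 * R := by
    rw [norm_mul, hI, Complex.norm_real, Real.norm_eq_abs, abs_of_pos (by positivity)]; linarith
  have p1 := F_trans h hI hR _ nr P
  have p2 := F_trans h h1 hR _ nr P
  have p3 := F_trans h h1 hR _ nI Q1
  rw [← hQ1] at p1 p2
  rw [← hQ2] at p3
  rw [← ha] at s1
  rw [← hb] at p1
  rw [← ha] at p2
  have hWab : ‖W - (a + b)‖ ≤ 109 * τ := by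
    rw [e]
    have : F f 1 (r / 2) P / 2 + F f Complex.I r Q1 + F f 1 (r / 2) Q2 / 2 - (a + b) =
      (1 / 2 : ℝ) * (F f 1 (r / 2) P - a) + ((F f Complex.I r Q1 - F f Complex.I R Q1) +
        (F f Complex.I R Q1 - b)) + (1 / 2 : ℝ) * ((F f 1 (r / 2) Q2 - F f 1 R Q2) +
        ((F f 1 R Q2 - F f 1 R Q1) + (F f 1 R Q1 - a))) := by push_cast; ring
    rw [this]
    have nn : ∀ z : ℂ, ‖((1 / 2 : ℝ) : ℂ) * z‖ = 1 / 2 * ‖z‖ := fun z => by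
      rw [norm_mul, Complex.norm_real]; norm_num
    refine (norm_add₃_le).trans ?_
    rw [nn, nn]
    have q1 := norm_add_le (F f Complex.I r Q1 - F f Complex.I R Q1) (F f Complex.I R Q1 - b)
    have q2 := norm_add_le (F f 1 (r / 2) Q2 - F f 1 R Q2)
      ((F f 1 R Q2 - F f 1 R Q1) + (F f 1 R Q1 - a))
    have q3 := norm_add_le (F f 1 R Q2 - F f 1 R Q1) (F f 1 R Q1 - a)
    linarith
  have hWn : ‖W‖ = ‖Dl f P ((r : ℂ) * (1 + Complex.I))‖ / r := by
    rw [hW, norm_div, Complex.norm_real, Real.norm_eq_abs, abs_of_pos hrp]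
  have n2 : ‖(r : ℂ) * (1 + Complex.I)‖ = r * Real.sqrt 2 := by
    rw [norm_mul, Complex.norm_real, Real.norm_eq_abs, abs_of_pos hrp, norm_sqrt]
    congr 2; simp; norm_num
  have wu := Dl_upper h.bl P ((r : ℂ) * (1 + Complex.I))
  have wl := Dl_lower h.pos (by linarith) h.bl P ((r : ℂ) * (1 + Complex.I))
  rw [n2] at wu wl
  have wu' : ‖W‖ ≤ (1 + τ ^ 8) * Real.sqrt 2 := by
    rw [hWn, div_le_iff₀ hrp]; linarith
  have wl' : (1 - 200 * τ ^ 4) * Real.sqrt 2 ≤ ‖W‖ := by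
    rw [hWn, le_div_iff₀ hrp]; linarith
  have q2 : Real.sqrt 2 ^ 2 = 2 := Real.sq_sqrt (by norm_num)
  have wu2 : ‖W‖ ^ 2 ≤ ((1 + τ ^ 8) * Real.sqrt 2) ^ 2 := pow_le_pow_left₀ (norm_nonneg _) wu' 2
  have wl2 : ((1 - 200 * τ ^ 4) * Real.sqrt 2) ^ 2 ≤ ‖W‖ ^ 2 :=
    pow_le_pow_left₀ (mul_nonneg (by linarith) (Real.sqrt_nonneg _)) wl' 2
  rw [mul_pow, q2] at wu2 wl2
  have au := F_le h h1 hR P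
  have al := F_ge h h1 hR P
  have bu := F_le h hI hR P
  have bl := F_ge h hI hR P
  rw [← ha] at au al
  rw [← hb] at bu bl
  have au2 : ‖a‖ ^ 2 ≤ (1 + τ ^ 8) ^ 2 := pow_le_pow_left₀ (norm_nonneg _) au 2
  have bu2 : ‖b‖ ^ 2 ≤ (1 + τ ^ 8) ^ 2 := pow_le_pow_left₀ (norm_nonneg _) bu 2
  have al2 : (1 - 200 * τ ^ 4) ^ 2 ≤ ‖a‖ ^ 2 := pow_le_pow_left₀ (by linarith) al 2
  have bl2 : (1 - 200 * τ ^ 4) ^ 2 ≤ ‖b‖ ^ 2 := pow_le_pow_left₀ (by linarith) bl 2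
  have E1 : (1 + τ ^ 8) ^ 2 ≤ 1 + τ := h.E1
  have E2 : 1 - τ ≤ (1 - 200 * τ ^ 4) ^ 2 := h.E2
  have hab := nsq_add a b
  have nab := norm_add_le a b
  have W15 : ‖W‖ ≤ 1.5 := by
    refine le_of_abs_le (abs_le_of_sq_le_sq ?_ (by norm_num))
    norm_num; linarith
  have n3 := abs_norm_sub_norm_le W (a + b)
  have n4 := abs_le.1 (n3.trans hWab)
  have nz := norm_nonneg (a + b)
  have wz := norm_nonneg W
  have S : ‖W‖ + ‖a + b‖ ≤ 3.6 := by linarith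
  have D1 : (‖W‖ - ‖a + b‖) * (‖W‖ + ‖a + b‖) ≤ 109 * τ * 3.6 := by
    have := mul_le_mul_of_nonneg_right n4.2 (by linarith : 0 ≤ ‖W‖ + ‖a + b‖)
    have := mul_le_mul_of_nonneg_left S (by linarith : 0 ≤ 109 * τ)
    linarith
  have D2 : (‖a + b‖ - ‖W‖) * (‖W‖ + ‖a + b‖) ≤ 109 * τ * 3.6 := by
    have := mul_le_mul_of_nonneg_right (by linarith [n4.1] : ‖a + b‖ - ‖W‖ ≤ 109 * τ) (by linarith : 0 ≤ ‖W‖ + ‖a + b‖)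
    have := mul_le_mul_of_nonneg_left S (by linarith : 0 ≤ 109 * τ)
    linarith
  rw [abs_le]
  constructor <;> linarith

def dt (z w : ℂ) : ℝ := z.re * w.im - z.im * w.re

lemma F_dt {f : H → H} {τ : ℝ} (h : Good f τ) {R : ℝ} (hR : 0 < R) (P : H) :
    dt (F f 1 R P) (F f Complex.I R P) ≠ 0 ∧ ∀ s : ℝ, (s = 1 ∨ s = -1) →
      0 < s * dt (F f 1 R P) (F f Complex.I R P) →
      ‖F f Complex.I R P - s * Complex.I * F f 1 R P‖ ≤ 400 * τ := by
  have tp := h.pos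
  have ts := h.small
  have t8 := h.t8
  have t4 := h.t4
  have t40 : 0 < τ ^ 4 := by positivity
  have t80 : 0 < τ ^ 8 := by positivity
  have hI : ‖Complex.I‖ = 1 := by simp
  have h1 : ‖(1:ℂ)‖ = 1 := by simp
  have hp := F_perp h hR P
  have au := F_le h h1 hR P
  have al := F_ge h h1 hR P
  have bu := F_le h hI hR P
  have bl := F_ge h hI hR P
  set a := F f 1 R P with ha
  set b := F f Complex.I R P with hb
  have id1 : dt a b ^ 2 = (‖a‖ * ‖b‖) ^ 2 - ip a b ^ 2 := by
    rw [mul_pow, nsq, nsq, dt, ip]; ring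
  have ip2 : ip a b ^ 2 ≤ (200 * τ) ^ 2 := by
    rw [← sq_abs]; exact pow_le_pow_left₀ (abs_nonneg _) hp 2
  have nn : 0.9 ≤ ‖a‖ * ‖b‖ := by nlinarith
  have pos : 0 < dt a b ^ 2 := by nlinarith
  refine ⟨fun h0 => by rw [h0] at pos; norm_num at pos, fun s hs hsd => ?_⟩
  have id2 : ‖b - s * Complex.I * a‖ ^ 2 = ‖b‖ ^ 2 + ‖a‖ ^ 2 - 2 * (s * dt a b) := by
    rw [nsq, nsq, nsq, dt]
    rcases hs with rfl | rfl <;> simp <;> ring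
  set d := s * dt a b with hd
  have d2 : d ^ 2 = dt a b ^ 2 := by
    rw [hd, mul_pow]; rcases hs with rfl | rfl <;> ring
  refine le_of_abs_le (abs_le_of_sq_le_sq ?_ (by positivity))
  rw [id2]
  have g1 : (‖a‖ * ‖b‖ - d) * (‖a‖ * ‖b‖ + d) ≤ (200 * τ) ^ 2 := by nlinarith
  have g2 : ‖a‖ * ‖b‖ - d ≤ 1.2 * (200 * τ) ^ 2 := by
    by_contra hc
    push Not at hc
    have : 0 < (200 * τ) ^ 2 := by positivity
    nlinarith
  have g3 : (‖a‖ - ‖b‖) ^ 2 ≤ τ ^ 2 := by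
    apply sq_le_sq' <;> linarith
  nlinarith

lemma pr_cont {f : H → H} {τ : ℝ} (h : Good f τ) : Continuous fun P => pr (f P) := by
  rw [continuous_iff_continuousAt]
  intro P
  have key : Filter.Tendsto (fun Q : H => (1 + τ ^ 8) * (‖pr (Hmul (Hinv P) Q)‖ +
      2 * Real.sqrt |(Hmul (Hinv P) Q).2.2|)) (nhds P) (nhds 0) := by
    have : Continuous (fun Q : H => (1 + τ ^ 8) * (‖pr (Hmul (Hinv P) Q)‖ +
      2 * Real.sqrt |(Hmul (Hinv P) Q).2.2|)) := by
      simp only [norm_sqrt, pr, Hmul, Hinv]; fun_prop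
    have t := this.tendsto P
    convert t using 2
    simp [norm_sqrt, pr, Hmul, Hinv]
  rw [ContinuousAt, tendsto_iff_norm_sub_tendsto_zero]
  refine squeeze_zero (fun _ => norm_nonneg _) (fun Q => ?_) key
  have := pr_lip h P (Hmul (Hinv P) Q)
  rwa [Hmul_inv_cancel] at this

lemma F_cont {f : H → H} {τ : ℝ} (h : Good f τ) (v : ℂ) (R : ℝ) : Continuous (F f v R) := by
  have := pr_cont h
  have h2 : Continuous (fun P : H => Hmul P (hz (R * v))) := by
    simp only [Hmul]; fun_prop
  have h3 := this.comp h2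
  unfold F Dl
  exact (h3.sub this).div_const _

lemma F_sign {f : H → H} {τ : ℝ} (h : Good f τ) {R : ℝ} (hR : 0 < R) :
    ∃ s : ℝ, (s = 1 ∨ s = -1) ∧ ∀ P, ‖F f Complex.I R P - s * Complex.I * F f 1 R P‖ ≤ 400 * τ := by
  have hc : Continuous (fun P => dt (F f 1 R P) (F f Complex.I R P)) := by
    have c1 := F_cont h 1 R
    have c2 := F_cont h Complex.I R
    have r1 := Complex.continuous_re.comp c1
    have i1 := Complex.continuous_im.comp c1
    have r2 := Complex.continuous_re.comp c2
    have i2 := Complex.continuous_im.comp c2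
    exact (r1.mul i2).sub (i1.mul r2)
  have hne := fun P => (F_dt h hR P).1
  have hpc : IsPreconnected (Set.range (fun P => dt (F f 1 R P) (F f Complex.I R P))) :=
    isPreconnected_range hc
  have dich : (∀ P, 0 < dt (F f 1 R P) (F f Complex.I R P)) ∨
      (∀ P, dt (F f 1 R P) (F f Complex.I R P) < 0) := by
    by_contra hcon
    push Not at hcon
    obtain ⟨⟨P, hP⟩, Q, hQ⟩ := hcon
    obtain ⟨S, hS⟩ := hpc.ordConnected.out ⟨P, rfl⟩ ⟨Q, rfl⟩ ⟨hP, hQ⟩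
    exact hne S hS
  rcases dich with hd | hd
  · exact ⟨1, Or.inl rfl, fun P => (F_dt h hR P).2 1 (Or.inl rfl) (by simpa using hd P)⟩
  · exact ⟨-1, Or.inr rfl, fun P => (F_dt h hR P).2 (-1) (Or.inr rfl) (by simpa using hd P)⟩

lemma F_lineI {f : H → H} {τ : ℝ} (h : Good f τ) {R : ℝ} (hR : 0 < R) {s : ℝ}
    (hs2 : |s| ≤ 2 * R) (P : H) :
    ‖F f 1 R (Hmul P (hz (s * Complex.I))) - F f 1 R P‖ ≤ 801 * τ := by
  obtain ⟨σ, hσ, hF⟩ := F_sign h hR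
  have h1 := hF P
  have h2 := hF (Hmul P (hz (s * Complex.I)))
  have h3 := F_line h (v := Complex.I) (by simp) hR hs2 P
  set Q := Hmul P (hz (s * Complex.I))
  have hn : ‖(σ : ℂ) * Complex.I‖ = 1 := by rcases hσ with rfl | rfl <;> simp
  have e : ‖F f 1 R Q - F f 1 R P‖ = ‖σ * Complex.I * (F f 1 R Q - F f 1 R P)‖ := by
    rw [norm_mul, hn, one_mul]
  rw [e]
  rw [show σ * Complex.I * (F f 1 R Q - F f 1 R P) =
    -(F f Complex.I R Q - σ * Complex.I * F f 1 R Q) + (F f Complex.I R P - σ * Complex.I * F f 1 R P)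
    + (F f Complex.I R Q - F f Complex.I R P) by ring]
  refine norm_add₃_le.trans ?_
  rw [norm_neg]; linarith

lemma F_near1 {f : H → H} {τ : ℝ} (h : Good f τ) {R : ℝ} (hR : 0 < R) (P Q : H)
    (hd : dH P Q < 2 * R) : ‖F f 1 R Q - F f 1 R P‖ ≤ 3000 * τ := by
  have tp := h.pos
  set q := Hmul (Hinv P) Q with hq
  have hQ : Q = Hmul P q := by rw [hq, Hmul_inv_cancel]
  have d0 := dH_nonneg P Q
  have hv := dH_vertO q
  have hz' := dH_hor HO q
  rw [hq, ← dH_O', ← hq] at hv hz'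
  have hsq := nsq (pr q - pr HO)
  have hre : (pr q - pr HO).re = q.1 := by simp [pr, HO]
  have him : (pr q - pr HO).im = q.2.1 := by simp [pr, HO]
  rw [hre, him] at hsq
  have n0 := norm_nonneg (pr q - pr HO)
  have hN : ‖pr q - pr HO‖ ≤ 2 * R := by linarith
  have hN2 : ‖pr q - pr HO‖ ^ 2 ≤ (2 * R) ^ 2 := pow_le_pow_left₀ n0 hN 2
  have hx : |q.1| ≤ 2 * R := abs_le_of_sq_le_sq (by nlinarith [sq_nonneg q.2.1]) (by positivity)
  have hy : |q.2.1| ≤ 2 * R := abs_le_of_sq_le_sq (by nlinarith [sq_nonneg q.1]) (by positivity)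
  set T := q.2.2 + 2 * q.1 * q.2.1 with hT
  have hTb : |T| ≤ 16 * R ^ 2 := by
    have h1 : |2 * q.1 * q.2.1| ≤ 8 * R ^ 2 := by
      rw [abs_mul, abs_mul, abs_two]
      have := mul_le_mul hx hy (abs_nonneg _) (by positivity)
      nlinarith
    have h2 : dH P Q ^ 2 ≤ (2 * R) ^ 2 := pow_le_pow_left₀ d0 hd.le 2
    have := abs_add_le q.2.2 (2 * q.1 * q.2.1)
    rw [hT]; nlinarith
  have hab : ∃ a b : ℝ, |a| ≤ 2 * R ∧ |b| ≤ 2 * R ∧ -4 * a * b = T := by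
    have hs := Real.mul_self_sqrt (abs_nonneg T)
    have hp := Real.sqrt_nonneg |T|
    have hle : Real.sqrt |T| ≤ 4 * R := Real.sqrt_le_iff.2 ⟨by positivity, by linarith⟩
    have hab : |Real.sqrt |T| / 2| ≤ 2 * R := by
      rw [abs_of_nonneg (by positivity)]; linarith
    rcases le_total 0 T with h | h
    · refine ⟨Real.sqrt |T| / 2, -(Real.sqrt |T| / 2), hab, (by rwa [abs_neg]), ?_⟩
      rw [abs_of_nonneg h] at *; nlinarith
    · refine ⟨Real.sqrt |T| / 2, Real.sqrt |T| / 2, hab, hab, ?_⟩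
      rw [abs_of_nonpos h] at *; nlinarith
  obtain ⟨a, b, ha, hb, hTab⟩ := hab
  have eQ : Q = Hmul (Hmul (Hmul (Hmul (Hmul (Hmul P (hz (q.1 * (1 : ℂ)))) (hz (q.2.1 * Complex.I)))
      (hz (a * (1 : ℂ)))) (hz (b * Complex.I))) (hz ((-a : ℝ) * (1 : ℂ)))) (hz ((-b : ℝ) * Complex.I)) := by
    have e2 : q.2.2 = -4 * a * b - 2 * q.1 * q.2.1 := by rw [hTab, hT]; ring
    rw [hQ]
    simp only [Hmul, hz, e2]; ext <;> simp
    ring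
  have hone : ‖(1 : ℂ)‖ = 1 := by simp
  set Q1 := Hmul P (hz (q.1 * (1 : ℂ))) with hQ1
  set Q2 := Hmul Q1 (hz (q.2.1 * Complex.I)) with hQ2
  set Q3 := Hmul Q2 (hz (a * (1 : ℂ))) with hQ3
  set Q4 := Hmul Q3 (hz (b * Complex.I)) with hQ4
  set Q5 := Hmul Q4 (hz ((-a : ℝ) * (1 : ℂ))) with hQ5
  have k1 := F_line h hone hR hx P
  have k2 := F_lineI h hR hy Q1
  have k3 := F_line h hone hR ha Q2
  have k4 := F_lineI h hR hb Q3
  have k5 := F_line h hone hR (by rwa [abs_neg] : |-a| ≤ 2 * R) Q4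
  have k6 := F_lineI h hR (by rwa [abs_neg] : |-b| ≤ 2 * R) Q5
  rw [← eQ] at k6
  rw [← hQ1] at k1
  rw [← hQ2] at k2
  rw [← hQ3] at k3
  rw [← hQ4] at k4
  rw [← hQ5] at k5
  have l1 := norm_sub_le_norm_sub_add_norm_sub (F f 1 R Q) (F f 1 R Q5) (F f 1 R P)
  have l2 := norm_sub_le_norm_sub_add_norm_sub (F f 1 R Q5) (F f 1 R Q4) (F f 1 R P)
  have l3 := norm_sub_le_norm_sub_add_norm_sub (F f 1 R Q4) (F f 1 R Q3) (F f 1 R P)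
  have l4 := norm_sub_le_norm_sub_add_norm_sub (F f 1 R Q3) (F f 1 R Q2) (F f 1 R P)
  have l5 := norm_sub_le_norm_sub_add_norm_sub (F f 1 R Q2) (F f 1 R Q1) (F f 1 R P)
  linarith

lemma F_near {f : H → H} {τ : ℝ} (h : Good f τ) {R : ℝ} (hR : 0 < R) (P Q : H)
    (hd : dH P Q < 2 * R) {v : ℂ} (hv : v = 1 ∨ v = Complex.I) :
    ‖F f v R Q - F f v R P‖ ≤ 4000 * τ := by
  have h1 := F_near1 h hR P Q hd
  have tp := h.pos
  rcases hv with rfl | rfl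
  · linarith
  · obtain ⟨σ, hσ, hF⟩ := F_sign h hR
    have h2 := hF P
    have h3 := hF Q
    have hn : ‖(σ : ℂ) * Complex.I‖ = 1 := by rcases hσ with rfl | rfl <;> simp
    have e : ‖F f 1 R Q - F f 1 R P‖ = ‖σ * Complex.I * (F f 1 R Q - F f 1 R P)‖ := by
      rw [norm_mul, hn, one_mul]
    rw [e] at h1
    rw [show F f Complex.I R Q - F f Complex.I R P =
      (F f Complex.I R Q - σ * Complex.I * F f 1 R Q) +
      -(F f Complex.I R P - σ * Complex.I * F f 1 R P) + σ * Complex.I * (F f 1 R Q - F f 1 R P) by ring]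
    refine norm_add₃_le.trans ?_
    rw [norm_neg]; linarith


def bw (s : ℝ) : ℝ := 1 + 2 * s - 4 * s ^ 2

set_option maxHeartbeats 1000000 in
lemma bell (h sp sm s : ℝ) (h1 : 0 ≤ sp) (h2 : 0 ≤ sm) (h3 : (sp + sm) / 2 + h ^ 2 ≤ s)
    (h4 : s ≤ 0.04) : (Real.exp h * bw sp + Real.exp (-h) * bw sm) / 2 ≤ bw s := by
  set m := (sp + sm) / 2 with hm
  set δ := (sp - sm) / 2 with hδ
  have esp : sp = m + δ := by rw [hm, hδ]; ring
  have esm : sm = m - δ := by rw [hm, hδ]; ring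
  have m0 : 0 ≤ m := by rw [hm]; linarith
  have hsq : h ^ 2 ≤ 0.04 := by linarith
  have habs : |h| ≤ 0.2 := abs_le_of_sq_le_sq (by linarith) (by norm_num)
  have hc : (Real.exp h + Real.exp (-h)) / 2 ≤ 1 + h ^ 2 := by
    rw [← Real.cosh_eq]
    refine (Real.cosh_le_exp_half_sq h).trans ?_
    have := Real.abs_exp_sub_one_le (x := h ^ 2 / 2) (by rw [abs_of_nonneg (by positivity)]; linarith)
    rw [abs_of_nonneg (by positivity : 0 ≤ h ^ 2 / 2)] at this
    linarith [le_of_abs_le this]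
  have hs : |(Real.exp h - Real.exp (-h)) / 2| ≤ 1.2 * |h| := by
    have a1 := abs_le.1 (Real.abs_exp_sub_one_sub_id_le (x := h) (by linarith))
    have a2 := abs_le.1 (Real.abs_exp_sub_one_sub_id_le (x := -h) (by rw [abs_neg]; linarith))
    have a3 : h ^ 2 ≤ 0.2 * |h| := by rw [← sq_abs]; nlinarith [abs_nonneg h]
    have a4 := neg_abs_le h
    have a5 := le_abs_self h
    rw [abs_le]; constructor <;> nlinarith
  have e : (Real.exp h * bw sp + Real.exp (-h) * bw sm) / 2 =
      (Real.exp h + Real.exp (-h)) / 2 * (1 + 2 * m - 4 * m ^ 2 - 4 * δ ^ 2) +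
      (Real.exp h - Real.exp (-h)) / 2 * (2 * δ * (1 - 4 * m)) := by
    rw [esp, esm]; simp only [bw]; ring
  rw [e]
  have hδm : |δ| ≤ m := by rw [abs_le]; constructor <;> linarith
  have hm4 : m ≤ 0.04 := by nlinarith
  have hδ2 : δ ^ 2 ≤ m ^ 2 := by rw [← sq_abs]; exact pow_le_pow_left₀ (abs_nonneg _) hδm 2
  have c1 : (Real.exp h + Real.exp (-h)) / 2 * (1 + 2 * m - 4 * m ^ 2 - 4 * δ ^ 2) ≤
      (1 + h ^ 2) * (1 + 2 * m - 4 * m ^ 2 - 4 * δ ^ 2) :=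
    mul_le_mul_of_nonneg_right hc (by nlinarith)
  have c2 : (Real.exp h - Real.exp (-h)) / 2 * (2 * δ * (1 - 4 * m)) ≤ 1.2 * |h| * (2 * |δ|) := by
    refine (le_abs_self _).trans ?_
    rw [abs_mul]
    apply mul_le_mul hs _ (abs_nonneg _) (by positivity)
    rw [abs_mul, abs_mul, abs_two, abs_of_nonneg (by linarith : 0 ≤ 1 - 4 * m)]
    nlinarith [abs_nonneg δ]
  have c3 : bw (m + h ^ 2) ≤ bw s := by
    simp only [bw]
    have : 0 ≤ (s - (m + h ^ 2)) * (2 - 4 * (s + (m + h ^ 2))) :=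
      mul_nonneg (by linarith) (by linarith)
    nlinarith
  refine le_trans ?_ c3
  have q1 : 0.6 * h ^ 2 ≤ h ^ 2 * (1 - 10 * m - 4 * h ^ 2) := by nlinarith [sq_nonneg h]
  have q2 : 2.4 * (|h| * |δ|) ≤ 0.6 * h ^ 2 + 4 * δ ^ 2 := by
    rw [← sq_abs h, ← sq_abs δ]; nlinarith [sq_nonneg (0.6 * |h| - 1.2 * |δ|), sq_nonneg (|h|), sq_nonneg (|δ|)]
  have q3 : 0 ≤ h ^ 2 * δ ^ 2 := by positivity
  have q4 : 0 ≤ h ^ 2 * m ^ 2 := by positivity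
  simp only [bw]
  nlinarith

def U (f : H → H) (c v : ℂ) (k : ℝ) : ℕ → ℝ → H → ℝ
  | 0, l, P => Real.exp (k * ip c (F f v l P))
  | n + 1, l, P => (U f c v k n (l / 2) P + U f c v k n (l / 2) (Hmul P (hz ((l / 2 : ℝ) * v)))) / 2

lemma U_nonneg (f : H → H) (c v : ℂ) (k : ℝ) (n : ℕ) (l : ℝ) (P : H) : 0 ≤ U f c v k n l P := by
  induction n generalizing l P with
  | zero => simp only [U]; positivity
  | succ n ih => simp only [U]; have := ih (l / 2) P; have := ih (l / 2) (Hmul P (hz ((l / 2 : ℝ) * v))); linarith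

lemma U_cont {f : H → H} {τ : ℝ} (h : Good f τ) (c v : ℂ) (k : ℝ) (n : ℕ) (l : ℝ) :
    Continuous (U f c v k n l) := by
  induction n generalizing l with
  | zero =>
    have hF := F_cont h v l
    have r1 := Complex.continuous_re.comp hF
    have i1 := Complex.continuous_im.comp hF
    have : U f c v k 0 l = fun P => Real.exp (k * (c.re * (F f v l P).re + c.im * (F f v l P).im)) := rfl
    rw [this]
    exact Real.continuous_exp.comp (((r1.const_mul _).add (i1.const_mul _)).const_mul k)
  | succ n ih =>
    have h2 : Continuous (fun P : H => Hmul P (hz ((l / 2 : ℝ) * v))) := by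
      simp only [Hmul]; fun_prop
    have : U f c v k (n + 1) l = fun P => (U f c v k n (l / 2) P +
      U f c v k n (l / 2) (Hmul P (hz ((l / 2 : ℝ) * v)))) / 2 := rfl
    rw [this]
    exact ((ih (l / 2)).add ((ih (l / 2)).comp h2)).div_const 2

lemma F_split (f : H → H) (v : ℂ) {l : ℝ} (hl : 0 < l) (P : H) :
    F f v l P = (F f v (l / 2) P + F f v (l / 2) (Hmul P (hz ((l / 2 : ℝ) * v)))) / 2 := by
  have := Dl_add f P v (l / 2) (l / 2)
  rw [show l / 2 + l / 2 = l by ring] at this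
  simp only [F]
  rw [this]
  have l0 : (l : ℂ) ≠ 0 := by exact_mod_cast hl.ne'
  push_cast
  field_simp

lemma U_le {f : H → H} {τ : ℝ} (h : Good f τ) {c v : ℂ} (hv : ‖v‖ = 1) (hc : ‖c‖ = 1) (n : ℕ)
    {l : ℝ} (hl : 0 < l) (P : H) : U f c v τ⁻¹ n l P ≤ Real.exp (τ⁻¹ * ip c (F f v l P)) *
      bw (τ⁻¹ ^ 2 * ((1 + τ ^ 8) ^ 2 - ‖F f v l P‖ ^ 2)) := by
  have tp := h.pos
  set k := τ⁻¹ with hk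
  have hkp : 0 < k := by positivity
  have kt : k * τ = 1 := by rw [hk]; field_simp
  have S0 : ∀ {l : ℝ}, 0 < l → ∀ P, 0 ≤ k ^ 2 * ((1 + τ ^ 8) ^ 2 - ‖F f v l P‖ ^ 2) := by
    intro l hl P
    have := pow_le_pow_left₀ (norm_nonneg _) (F_le h hv hl P) 2
    exact mul_nonneg (by positivity) (by linarith)
  have S1 : ∀ {l : ℝ}, 0 < l → ∀ P, k ^ 2 * ((1 + τ ^ 8) ^ 2 - ‖F f v l P‖ ^ 2) ≤ 0.04 := by
    intro l hl P
    have t4 := h.t4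
    have t8 := h.t8
    have ts := h.small
    have t40 : 0 < τ ^ 4 := by positivity
    have t80 : 0 < τ ^ 8 := by positivity
    have a1 := pow_le_pow_left₀ (by linarith) (F_ge h hv hl P) 2
    have a2 : (1 + τ ^ 8) ^ 2 ≤ 1 + 3 * τ ^ 4 := by nlinarith
    have a3 : 1 - 400 * τ ^ 4 ≤ (1 - 200 * τ ^ 4) ^ 2 := by nlinarith
    have a4 : (1 + τ ^ 8) ^ 2 - ‖F f v l P‖ ^ 2 ≤ 403 * τ ^ 4 := by linarith
    refine (mul_le_mul_of_nonneg_left a4 (by positivity)).trans ?_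
    have : k ^ 2 * (403 * τ ^ 4) = 403 * τ ^ 2 := by
      calc k ^ 2 * (403 * τ ^ 4) = 403 * (k * τ) ^ 2 * τ ^ 2 := by ring
        _ = _ := by rw [kt]; ring
    rw [this]
    have := h.t2
    linarith
  induction n generalizing l P with
  | zero =>
    have a := S0 hl P
    have b := S1 hl P
    simp only [U]
    set s := k ^ 2 * ((1 + τ ^ 8) ^ 2 - ‖F f v l P‖ ^ 2)
    have : 1 ≤ bw s := by simp only [bw]; nlinarith
    exact le_mul_of_one_le_right (Real.exp_pos _).le this
  | succ n ih =>
    have hl2 : 0 < l / 2 := by positivity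
    have i1 := ih hl2 P
    have i2 := ih hl2 (Hmul P (hz ((l / 2 : ℝ) * v)))
    have a1 := S0 hl2 P
    have a2 := S0 hl2 (Hmul P (hz ((l / 2 : ℝ) * v)))
    have b := S1 hl P
    have sp := F_split f v hl P
    simp only [U]
    set Fp := F f v (l / 2) P
    set Fm := F f v (l / 2) (Hmul P (hz ((l / 2 : ℝ) * v)))
    set F0 := F f v l P
    set d := (Fp - Fm) / 2 with hd
    set t := k * ip c d with ht
    have e1 : k * ip c Fp = k * ip c F0 + t := by rw [ht, sp, hd]; simp [ip]; ring
    have e2 : k * ip c Fm = k * ip c F0 + -t := by rw [ht, sp, hd]; simp [ip]; ring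
    have e3 : (‖Fp‖ ^ 2 + ‖Fm‖ ^ 2) / 2 - ‖F0‖ ^ 2 = ‖d‖ ^ 2 := by
      rw [sp, hd]; simp only [nsq]; simp; ring
    have t2 : t ^ 2 ≤ k ^ 2 * ‖d‖ ^ 2 := by
      rw [ht, mul_pow]
      apply mul_le_mul_of_nonneg_left _ (by positivity)
      have := nsq c
      rw [hc] at this
      have e : ‖d‖ ^ 2 = (c.re ^ 2 + c.im ^ 2) * ‖d‖ ^ 2 := by rw [← this]; ring
      rw [e, nsq, ip]
      nlinarith [sq_nonneg (c.re * d.im - c.im * d.re)]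
    have B := bell t _ _ _ a1 a2 (by
      have : (k ^ 2 * ((1 + τ ^ 8) ^ 2 - ‖Fp‖ ^ 2) + k ^ 2 * ((1 + τ ^ 8) ^ 2 - ‖Fm‖ ^ 2)) / 2 +
        k ^ 2 * ‖d‖ ^ 2 = k ^ 2 * ((1 + τ ^ 8) ^ 2 - ‖F0‖ ^ 2) := by rw [← e3]; ring
      linarith) b
    rw [e1, Real.exp_add] at i1
    rw [e2, Real.exp_add] at i2
    have := mul_le_mul_of_nonneg_left B (Real.exp_pos (k * ip c F0)).le
    linarith

lemma U_le' {f : H → H} {τ : ℝ} (h : Good f τ) {c v : ℂ} (hv : ‖v‖ = 1) (hc : ‖c‖ = 1) (n : ℕ)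
    {l : ℝ} (hl : 0 < l) (P : H) : U f c v τ⁻¹ n l P ≤ Real.exp (τ⁻¹ * ip c (F f v l P)) * 2 := by
  refine (U_le h hv hc n hl P).trans ?_
  apply mul_le_mul_of_nonneg_left _ (Real.exp_pos _).le
  simp only [bw]
  nlinarith [sq_nonneg (τ⁻¹ ^ 2 * ((1 + τ ^ 8) ^ 2 - ‖F f v l P‖ ^ 2) - 1 / 4)]

lemma U_near {f : H → H} {τ : ℝ} (h : Good f τ) {c v : ℂ} (hv : v = 1 ∨ v = Complex.I)
    (hc : ‖c‖ = 1) (n : ℕ) {R : ℝ} (hR : 0 < R) (P Q : H) (hd : dH P Q < 2 * R) :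
    U f c v τ⁻¹ n R Q ≤ 2 * Real.exp 4000 * Real.exp (τ⁻¹ * ip c (F f v R P)) := by
  have tp := h.pos
  have hv1 : ‖v‖ = 1 := by rcases hv with rfl | rfl <;> simp
  refine (U_le' h hv1 hc n hR Q).trans ?_
  have h1 := F_near h hR P Q hd hv
  have h2 := ip_le c (F f v R Q - F f v R P)
  rw [hc, one_mul] at h2
  have h3 : ip c (F f v R Q - F f v R P) = ip c (F f v R Q) - ip c (F f v R P) := by
    simp [ip]; ring
  have h4 : ip c (F f v R Q) ≤ ip c (F f v R P) + 4000 * τ := by linarith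
  have h5 := mul_le_mul_of_nonneg_left h4 (inv_pos.2 tp).le
  have h6 : τ⁻¹ * (ip c (F f v R P) + 4000 * τ) = 4000 + τ⁻¹ * ip c (F f v R P) := by
    field_simp; ring
  rw [h6] at h5
  have h7 := Real.exp_le_exp.2 h5
  rw [Real.exp_add] at h7
  linarith


def BB (P : H) (R : ℝ) : Set H := {Q : H | dH P Q < R}

lemma shear_mp (a b c α β : ℝ) :
    MeasurePreserving (fun p : H => ((p.1 + a, p.2.1 + b, p.2.2 + (c + α * p.1 + β * p.2.1)) : H))
      volume volume := by
  have inner : ∀ x : ℝ, MeasurePreserving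
      (fun p : ℝ × ℝ => ((p.1 + b, p.2 + (c + α * x + β * p.1)) : ℝ × ℝ)) volume volume := by
    intro x
    have := (measurePreserving_add_right (volume : Measure ℝ) b).skew_product
      (μc := (volume : Measure ℝ)) (μd := (volume : Measure ℝ))
      (g := fun y t => t + (c + α * x + β * y)) (by unfold Function.uncurry; fun_prop)
      (Filter.Eventually.of_forall fun y => (measurePreserving_add_right (volume : Measure ℝ) _).map_eq)
    exact this
  have := (measurePreserving_add_right (volume : Measure ℝ) a).skew_product
      (μc := (volume : Measure (ℝ × ℝ))) (μd := (volume : Measure (ℝ × ℝ)))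
      (g := fun x p => ((p.1 + b, p.2 + (c + α * x + β * p.1)) : ℝ × ℝ))
      (by unfold Function.uncurry; fun_prop)
      (Filter.Eventually.of_forall fun x => (inner x).map_eq)
  exact this

lemma right_mp (q : H) : MeasurePreserving (fun p : H => Hmul p q) volume volume := by
  convert shear_mp q.1 q.2.1 q.2.2 (-2 * q.2.1) (2 * q.1) using 2 with p
  simp only [Hmul]; ext <;> simp; ring

lemma left_mp (q : H) : MeasurePreserving (fun p : H => Hmul q p) volume volume := by
  convert shear_mp q.1 q.2.1 q.2.2 (2 * q.2.1) (-2 * q.1) using 2 with p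
  simp only [Hmul]; ext <;> simp <;> ring

lemma BB_open (P : H) (R : ℝ) : IsOpen (BB P R) := by
  rw [isOpen_iff_mem_nhds]
  intro Q hQ
  have key : Filter.Tendsto (fun Q' : H => (‖pr (Hmul (Hinv Q) Q')‖ +
      2 * Real.sqrt |(Hmul (Hinv Q) Q').2.2|)) (nhds Q) (nhds 0) := by
    have : Continuous (fun Q' : H => (‖pr (Hmul (Hinv Q) Q')‖ +
      2 * Real.sqrt |(Hmul (Hinv Q) Q').2.2|)) := by
      simp only [norm_sqrt, pr, Hmul, Hinv]; fun_prop
    have t := this.tendsto Q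
    convert t using 2
    simp [norm_sqrt, pr, Hmul, Hinv]
  have hQ' : dH P Q < R := hQ
  filter_upwards [key.eventually (gt_mem_nhds (by linarith : 0 < R - dH P Q))] with Q' h'
  have h3 := dH_full Q (Hmul (Hinv Q) Q').1 (Hmul (Hinv Q) Q').2.1 (Hmul (Hinv Q) Q').2.2
  rw [show ((Hmul (Hinv Q) Q').1, (Hmul (Hinv Q) Q').2.1, (Hmul (Hinv Q) Q').2.2) = Hmul (Hinv Q) Q'
    from rfl, Hmul_inv_cancel] at h3
  rw [norm_sqrt] at h'
  have := dH_tri P Q Q'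
  change dH P Q' < R
  simp only [pr] at h'
  linarith

lemma BB_meas (P : H) (R : ℝ) : MeasurableSet (BB P R) := (BB_open P R).measurableSet

lemma BB_vol (P : H) (R : ℝ) : volume (BB P R) = volume (BB HO R) := by
  rw [← (left_mp P).measure_preimage (BB_meas P R).nullMeasurableSet]
  congr 1
  ext q
  simp [BB, dH_O]

lemma vol_box (A B C D : Set ℝ) : volume ((A ×ˢ (B ×ˢ C)) : Set H) = volume A * (volume B * volume C) := by
  rw [Measure.volume_eq_prod, Measure.prod_prod, Measure.volume_eq_prod, Measure.prod_prod]

lemma BB_up (P : H) {R : ℝ} (hR : 0 < R) : volume (BB P R) ≤ ENNReal.ofReal (16 * R ^ 4) := by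
  rw [BB_vol]
  have : BB HO R ⊆ (Set.Icc (-R) R ×ˢ (Set.Icc (-R) R ×ˢ Set.Icc (-(2 * R ^ 2)) (2 * R ^ 2)) : Set H) := by
    intro q hq
    have hd : dH HO q < R := hq
    have d0 := dH_nonneg HO q
    have hv := dH_vertO q
    have hz' := dH_hor HO q
    have hsq := nsq (pr q - pr HO)
    have hre : (pr q - pr HO).re = q.1 := by simp [pr, HO]
    have him : (pr q - pr HO).im = q.2.1 := by simp [pr, HO]
    rw [hre, him] at hsq
    have n0 := norm_nonneg (pr q - pr HO)
    have hN2 : ‖pr q - pr HO‖ ^ 2 ≤ R ^ 2 := pow_le_pow_left₀ n0 (by linarith) 2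
    have hx : |q.1| ≤ R := abs_le_of_sq_le_sq (by nlinarith [sq_nonneg q.2.1]) (by positivity)
    have hy : |q.2.1| ≤ R := abs_le_of_sq_le_sq (by nlinarith [sq_nonneg q.1]) (by positivity)
    have ht : |q.2.2| ≤ 2 * R ^ 2 := by nlinarith
    exact ⟨abs_le.1 hx, abs_le.1 hy, abs_le.1 ht⟩
  refine (measure_mono this).trans ?_
  rw [vol_box _ _ _ ∅, Real.volume_Icc, Real.volume_Icc, ← ENNReal.ofReal_mul (by linarith),
    ← ENNReal.ofReal_mul (by linarith)]
  apply ENNReal.ofReal_le_ofReal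
  nlinarith

lemma BB_low (P : H) {R : ℝ} (hR : 0 < R) : ENNReal.ofReal (R ^ 4 / 512) ≤ volume (BB P R) := by
  rw [BB_vol]
  have : (Set.Ioo (-(R / 8)) (R / 8) ×ˢ (Set.Ioo (-(R / 8)) (R / 8) ×ˢ
      Set.Ioo (-(R ^ 2 / 64)) (R ^ 2 / 64)) : Set H) ⊆ BB HO R := by
    rintro ⟨x, y, t⟩ ⟨hx, hy, ht⟩
    simp only at hx hy ht
    have h := dH_full HO x y t
    rw [show Hmul HO (x, y, t) = (x, y, t) by simp [Hmul, HO]] at h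
    have hx2 : x ^ 2 ≤ (R / 8) ^ 2 := sq_le_sq' hx.1.le hx.2.le
    have hy2 : y ^ 2 ≤ (R / 8) ^ 2 := sq_le_sq' hy.1.le hy.2.le
    have h1 : Real.sqrt (x ^ 2 + y ^ 2) ≤ R / 4 := Real.sqrt_le_iff.2 ⟨by positivity, by nlinarith⟩
    have h2 : Real.sqrt |t| ≤ R / 8 := Real.sqrt_le_iff.2 ⟨by positivity, by
      have := abs_le.2 ⟨ht.1.le, ht.2.le⟩; nlinarith⟩
    change dH HO (x, y, t) < R
    linarith
  refine le_trans ?_ (measure_mono this)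
  rw [vol_box _ _ _ ∅, Real.volume_Ioo, Real.volume_Ioo, ← ENNReal.ofReal_mul (by linarith),
    ← ENNReal.ofReal_mul (by linarith)]
  apply ENNReal.ofReal_le_ofReal
  nlinarith

lemma BB_double (P : H) {R : ℝ} (hR : 0 < R) :
    volume (BB P (2 * R)) ≤ ENNReal.ofReal 131072 * volume (BB P R) := by
  refine (BB_up P (by positivity)).trans (le_trans ?_ (mul_le_mul_right (BB_low P hR) _))
  rw [← ENNReal.ofReal_mul (by norm_num)]
  apply ENNReal.ofReal_le_ofReal
  nlinarith

lemma U_int {f : H → H} {τ : ℝ} (h : Good f τ) (c : ℂ) {v : ℂ} (hv : ‖v‖ = 1) (k : ℝ) (P₀ : H) (n : ℕ)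
    (l ρ : ℝ) (hl : 0 < l) : ∫⁻ Q in BB P₀ ρ, ENNReal.ofReal (U f c v k 0 (l / 2 ^ n) Q) ≤
      ∫⁻ Q in BB P₀ (ρ + l), ENNReal.ofReal (U f c v k n l Q) := by
  induction n generalizing l ρ with
  | zero =>
    rw [pow_zero, div_one]
    apply lintegral_mono_set
    intro Q hQ
    have : dH P₀ Q < ρ := hQ
    change dH P₀ Q < ρ + l
    linarith
  | succ n ih =>
    have hl2 : 0 < l / 2 := by positivity
    have i := ih (l / 2) ρ hl2
    rw [show l / 2 / 2 ^ n = l / 2 ^ (n + 1) by rw [pow_succ]; field_simp] at i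
    refine i.trans ?_
    set e := hz ((l / 2 : ℝ) * v) with he
    have hm : Measurable fun Q => ENNReal.ofReal (U f c v k n (l / 2) Q) :=
      (U_cont h c v k n (l / 2)).measurable.ennreal_ofReal
    have hm2 : Measurable fun Q => ENNReal.ofReal (U f c v k n (l / 2) (Hmul Q e)) :=
      hm.comp (right_mp e).measurable
    have A1 : ∫⁻ Q in BB P₀ (ρ + l / 2), ENNReal.ofReal (U f c v k n (l / 2) Q) ≤
        ∫⁻ Q in BB P₀ (ρ + l), ENNReal.ofReal (U f c v k n (l / 2) Q) := by
      apply lintegral_mono_set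
      intro Q hQ
      have : dH P₀ Q < ρ + l / 2 := hQ
      change dH P₀ Q < ρ + l
      linarith
    have A2 : ∫⁻ Q in BB P₀ (ρ + l / 2), ENNReal.ofReal (U f c v k n (l / 2) Q) ≤
        ∫⁻ Q in BB P₀ (ρ + l), ENNReal.ofReal (U f c v k n (l / 2) (Hmul Q e)) := by
      rw [← (right_mp e).setLIntegral_comp_preimage (BB_meas P₀ (ρ + l / 2)) hm]
      apply lintegral_mono_set
      intro Q hQ
      have h1 : dH P₀ (Hmul Q e) < ρ + l / 2 := hQ
      have h2 := dH_tri P₀ (Hmul Q e) Q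
      have h3 := dH_hz (Hmul Q e) ((-(l / 2) : ℝ) * v)
      rw [he, hz_add, add_neg_cancel, hz_zero, norm_mul, hv, Complex.norm_real, Real.norm_eq_abs,
        abs_neg, abs_of_pos hl2, mul_one, ← he] at h3
      change dH P₀ Q < ρ + l
      linarith
    have e2 : ∀ Q, ENNReal.ofReal (U f c v k (n + 1) l Q) =
        2⁻¹ * (ENNReal.ofReal (U f c v k n (l / 2) Q) + ENNReal.ofReal (U f c v k n (l / 2) (Hmul Q e))) := by
      intro Q
      simp only [U]
      rw [← ENNReal.ofReal_add (U_nonneg _ _ _ _ _ _ _) (U_nonneg _ _ _ _ _ _ _), div_eq_inv_mul,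
        ENNReal.ofReal_mul (by norm_num), ENNReal.ofReal_inv_of_pos (by norm_num), ENNReal.ofReal_ofNat]
    simp only [e2]
    rw [lintegral_const_mul' _ _ (by norm_num), lintegral_add_left hm]
    set X := ∫⁻ Q in BB P₀ (ρ + l / 2), ENNReal.ofReal (U f c v k n (l / 2) Q)
    calc X = 2⁻¹ * (X + X) := by
          rw [← two_mul, ← mul_assoc, ENNReal.inv_mul_cancel (by norm_num) (by norm_num), one_mul]
      _ ≤ _ := by gcongr

def MM : ℝ := 2 * Real.exp 4000 * 131072

lemma U_key {f : H → H} {τ : ℝ} (h : Good f τ) {c v : ℂ} (hv : v = 1 ∨ v = Complex.I)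
    (hc : ‖c‖ = 1) (n : ℕ) {R : ℝ} (hR : 0 < R) (P : H) :
    ∫⁻ Q in BB P R, ENNReal.ofReal (Real.exp (τ⁻¹ * (ip c (F f v (R / 2 ^ n) Q) - ip c (F f v R P)))) ≤
      ENNReal.ofReal MM * volume (BB P R) := by
  have hv1 : ‖v‖ = 1 := by rcases hv with rfl | rfl <;> simp
  set E := Real.exp (τ⁻¹ * ip c (F f v R P)) with hE
  have hEp : 0 < E := Real.exp_pos _
  have e1 : ∀ Q, ENNReal.ofReal (Real.exp (τ⁻¹ * (ip c (F f v (R / 2 ^ n) Q) - ip c (F f v R P)))) =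
      ENNReal.ofReal E⁻¹ * ENNReal.ofReal (U f c v τ⁻¹ 0 (R / 2 ^ n) Q) := by
    intro Q
    rw [← ENNReal.ofReal_mul (by positivity), mul_sub, sub_eq_add_neg, Real.exp_add, Real.exp_neg,
      ← hE, mul_comm]
    rfl
  simp only [e1]
  rw [lintegral_const_mul _ (U_cont h c v _ 0 _).measurable.ennreal_ofReal]
  have i := U_int h c hv1 τ⁻¹ P n R R hR
  have b : ∫⁻ Q in BB P (R + R), ENNReal.ofReal (U f c v τ⁻¹ n R Q) ≤
      ENNReal.ofReal (2 * Real.exp 4000 * E) * volume (BB P (2 * R)) := by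
    rw [← two_mul, ← setLIntegral_const]
    apply setLIntegral_mono' (BB_meas _ _)
    intro Q hQ
    exact ENNReal.ofReal_le_ofReal (U_near h hv hc n hR P Q hQ)
  calc _ ≤ ENNReal.ofReal E⁻¹ * (ENNReal.ofReal (2 * Real.exp 4000 * E) *
        (ENNReal.ofReal 131072 * volume (BB P R))) := by
        gcongr
        exact (i.trans b).trans (by gcongr; exact BB_double P hR)
    _ = _ := by
      rw [← mul_assoc, ← mul_assoc, ← ENNReal.ofReal_mul (by positivity),
        ← ENNReal.ofReal_mul (by positivity)]
      congr 2
      rw [MM]; field_simp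

lemma pansu_lim {f : H → H} {A : Matrix (Fin 2) (Fin 2) ℝ} {P : H} (hp : HasPansuJacobianAt f A P)
    (v : ℂ) {R : ℝ} (hR : 0 < R) (c : ℂ) :
    Filter.Tendsto (fun n : ℕ => ip c (F f v (R / 2 ^ n) P)) Filter.atTop
      (nhds (ip c ⟨A 0 0 * v.re + A 0 1 * v.im, A 1 0 * v.re + A 1 1 * v.im⟩)) := by
  have hpow : Filter.Tendsto (fun n : ℕ => R / 2 ^ n) Filter.atTop (nhds 0) := by
    have := (tendsto_pow_atTop_nhds_zero_of_lt_one (by norm_num : (0:ℝ) ≤ 1 / 2) (by norm_num)).const_mul R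
    simpa [div_eq_mul_inv] using this
  have key : ∀ δ > 0, ∀ᶠ n : ℕ in Filter.atTop,
      |(F f v (R / 2 ^ n) P).re - (A 0 0 * v.re + A 0 1 * v.im)| < δ ∧
      |(F f v (R / 2 ^ n) P).im - (A 1 0 * v.re + A 1 1 * v.im)| < δ := by
    intro δ hδ
    obtain ⟨σ₀, h0, hσ⟩ := hp {hz v} isCompact_singleton δ hδ
    filter_upwards [hpow.eventually (gt_mem_nhds h0)] with n hn
    have hpos : 0 < R / 2 ^ n := by positivity
    have := hσ (R / 2 ^ n) hpos hn (hz v) rfl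
    set σ := R / 2 ^ n
    rw [Prod.dist_eq, max_lt_iff, Prod.dist_eq, max_lt_iff, Real.dist_eq, Real.dist_eq] at this
    obtain ⟨a1, a2, -⟩ := this
    have ed : Hdil σ (hz v) = hz (σ * v) := by simp [Hdil, hz]
    rw [ed] at a1 a2
    have eF : F f v σ P = (σ⁻¹ : ℝ) * (pr (f (Hmul P (hz (σ * v)))) - pr (f P)) := by
      simp only [F, Dl]; push_cast; ring
    rw [eF, Complex.re_ofReal_mul, Complex.im_ofReal_mul]
    generalize Hmul P (hz (σ * v)) = W at *
    simp only [Hdil, Hmul, Hinv, hz, neg_add_eq_sub] at a1 a2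
    exact ⟨a1, a2⟩
  have tr : Filter.Tendsto (fun n : ℕ => (F f v (R / 2 ^ n) P).re) Filter.atTop
      (nhds (A 0 0 * v.re + A 0 1 * v.im)) := by
    rw [Metric.tendsto_nhds]
    intro δ hδ
    filter_upwards [key δ hδ] with n hn using hn.1
  have ti : Filter.Tendsto (fun n : ℕ => (F f v (R / 2 ^ n) P).im) Filter.atTop
      (nhds (A 1 0 * v.re + A 1 1 * v.im)) := by
    rw [Metric.tendsto_nhds]
    intro δ hδ
    filter_upwards [key δ hδ] with n hn using hn.2
  exact (tr.const_mul c.re).add (ti.const_mul c.im)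

lemma J_key {f : H → H} {τ : ℝ} (h : Good f τ) {c v : ℂ} (hv : v = 1 ∨ v = Complex.I)
    (hc : ‖c‖ = 1) {R : ℝ} (hR : 0 < R) (P : H) (Jf : H → Matrix (Fin 2) (Fin 2) ℝ)
    (hJ : ∀ᵐ P ∂volume, HasPansuJacobianAt f (Jf P) P) :
    ∫⁻ Q in BB P R, ENNReal.ofReal (Real.exp (τ⁻¹ * (ip c ⟨Jf Q 0 0 * v.re + Jf Q 0 1 * v.im,
        Jf Q 1 0 * v.re + Jf Q 1 1 * v.im⟩ - ip c (F f v R P)))) ≤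
      ENNReal.ofReal MM * volume (BB P R) := by
  set G : ℕ → H → ENNReal := fun n Q =>
    ENNReal.ofReal (Real.exp (τ⁻¹ * (ip c (F f v (R / 2 ^ n) Q) - ip c (F f v R P)))) with hG
  have hGm : ∀ n, Measurable (G n) := by
    intro n
    have hF := F_cont h v (R / 2 ^ n)
    have r1 := Complex.continuous_re.comp hF
    have i1 := Complex.continuous_im.comp hF
    have : Continuous fun Q => Real.exp (τ⁻¹ * (ip c (F f v (R / 2 ^ n) Q) - ip c (F f v R P))) :=
      Real.continuous_exp.comp ((((r1.const_mul c.re).add (i1.const_mul c.im)).sub continuous_const).const_mul _)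
    exact this.measurable.ennreal_ofReal
  have e : ∫⁻ Q in BB P R, ENNReal.ofReal (Real.exp (τ⁻¹ * (ip c ⟨Jf Q 0 0 * v.re + Jf Q 0 1 * v.im,
        Jf Q 1 0 * v.re + Jf Q 1 1 * v.im⟩ - ip c (F f v R P)))) =
      ∫⁻ Q in BB P R, Filter.liminf (fun n => G n Q) Filter.atTop := by
    apply lintegral_congr_ae
    filter_upwards [ae_restrict_of_ae hJ] with Q hQ
    have t := pansu_lim hQ v hR c
    have t2 := (ENNReal.continuous_ofReal.tendsto _).comp ((Real.continuous_exp.tendsto _).comp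
      ((t.sub_const (ip c (F f v R P))).const_mul τ⁻¹))
    exact (Filter.Tendsto.liminf_eq t2).symm
  rw [e]
  refine (lintegral_liminf_le hGm).trans ?_
  refine Filter.liminf_le_of_le (by isBoundedDefault) (fun b hb => ?_)
  obtain ⟨n, hn⟩ := hb.exists
  exact hn.trans (U_key h hv hc n hR P)


lemma MM_pos : 0 < MM := by unfold MM; positivity

lemma MM_one : 1 ≤ MM := by
  unfold MM
  have := Real.add_one_le_exp (4000 : ℝ)
  linarith

lemma BB_fin (P : H) {R : ℝ} (hR : 0 < R) : volume (BB P R) ≠ ⊤ :=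
  ((BB_up P hR).trans_lt ENNReal.ofReal_lt_top).ne

lemma BB_pos (P : H) {R : ℝ} (hR : 0 < R) : 0 < (volume (BB P R)).toReal := by
  apply ENNReal.toReal_pos _ (BB_fin P hR)
  refine (lt_of_lt_of_le ?_ (BB_low P hR)).ne'
  exact ENNReal.ofReal_pos.2 (by positivity)

lemma J_ent {f : H → H} {τ : ℝ} (h : Good f τ) {R : ℝ} (hR : 0 < R) (P : H)
    (Jf : H → Matrix (Fin 2) (Fin 2) ℝ)
    (hJ : ∀ᵐ P ∂volume, HasPansuJacobianAt f (Jf P) P) (i j : Fin 2) :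
    ∃ a : ℝ, ∀ s : ℝ, (s = 1 ∨ s = -1) →
    ∫⁻ Q in BB P R, ENNReal.ofReal (Real.exp (τ⁻¹ * (s * (Jf Q i j - a)))) ≤
      ENNReal.ofReal MM * volume (BB P R) := by
  have main : ∀ c v : ℂ, ‖c‖ = 1 → (v = 1 ∨ v = Complex.I) →
      (∀ Q, Jf Q i j = ip c ⟨Jf Q 0 0 * v.re + Jf Q 0 1 * v.im,
        Jf Q 1 0 * v.re + Jf Q 1 1 * v.im⟩) → ∃ a : ℝ, ∀ s : ℝ, (s = 1 ∨ s = -1) →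
    ∫⁻ Q in BB P R, ENNReal.ofReal (Real.exp (τ⁻¹ * (s * (Jf Q i j - a)))) ≤
      ENNReal.ofReal MM * volume (BB P R) := by
    intro c v hc hv hQ
    refine ⟨ip c (F f v R P), fun s hs => ?_⟩
    have k := J_key h (c := s * c) hv (by rcases hs with rfl | rfl <;> simp [hc]) hR P Jf hJ
    refine le_trans (le_of_eq ?_) k
    congr 1
    ext Q
    rw [hQ]
    congr 3
    simp [ip]; ring
  fin_cases i <;> fin_cases j
  · exact main 1 1 (by simp) (Or.inl rfl) (fun Q => by simp [ip])
  · exact main 1 Complex.I (by simp) (Or.inr rfl) (fun Q => by simp [ip])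
  · exact main Complex.I 1 (by simp) (Or.inl rfl) (fun Q => by simp [ip])
  · exact main Complex.I Complex.I (by simp) (Or.inr rfl) (fun Q => by simp [ip])

def gg (τ a x : ℝ) : ℝ := Real.exp (τ⁻¹ * (1 * (x - a))) + Real.exp (τ⁻¹ * (-1 * (x - a)))

lemma gg_exp {τ : ℝ} (hτ : 0 < τ) (a x : ℝ) : Real.exp (|x - a| / τ) ≤ gg τ a x := by
  unfold gg
  rcases abs_cases (x - a) with ⟨e, -⟩ | ⟨e, -⟩ <;> rw [e]
  · rw [show (x - a) / τ = τ⁻¹ * (1 * (x - a)) by ring]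
    linarith [Real.exp_pos (τ⁻¹ * (-1 * (x - a)))]
  · rw [show -(x - a) / τ = τ⁻¹ * (-1 * (x - a)) by ring]
    linarith [Real.exp_pos (τ⁻¹ * (1 * (x - a)))]

lemma gg_abs {τ : ℝ} (hτ : 0 < τ) (a x : ℝ) : |x - a| ≤ τ * gg τ a x := by
  have h1 := gg_exp hτ a x
  have h2 := Real.add_one_le_exp (|x - a| / τ)
  have : |x - a| / τ ≤ gg τ a x := by linarith
  rwa [div_le_iff₀ hτ, mul_comm] at this

lemma J_int {f : H → H} {τ : ℝ} (h : Good f τ) {R : ℝ} (hR : 0 < R) (P : H)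
    (Jf : H → Matrix (Fin 2) (Fin 2) ℝ) (hm : ∀ i j : Fin 2, Measurable fun P : H => Jf P i j)
    (hJ : ∀ᵐ P ∂volume, HasPansuJacobianAt f (Jf P) P) (i j : Fin 2) :
    ∃ a : ℝ, IntegrableOn (fun Q => gg τ a (Jf Q i j)) (BB P R) ∧
      ∫ Q in BB P R, gg τ a (Jf Q i j) ≤ 2 * MM * (volume (BB P R)).toReal ∧
      |(volume (BB P R)).toReal⁻¹ * (∫ Q in BB P R, Jf Q i j) - a| ≤ 2 * MM * τ := by
  obtain ⟨a, ha⟩ := J_ent h hR P Jf hJ i j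
  have tp := h.pos
  have fin := BB_fin P hR
  have Vp := BB_pos P hR
  have key : ∀ s : ℝ, (s = 1 ∨ s = -1) →
      IntegrableOn (fun Q => Real.exp (τ⁻¹ * (s * (Jf Q i j - a)))) (BB P R) ∧
      ∫ Q in BB P R, Real.exp (τ⁻¹ * (s * (Jf Q i j - a))) ≤ MM * (volume (BB P R)).toReal := by
    intro s hs
    have m : Measurable (fun Q => Real.exp (τ⁻¹ * (s * (Jf Q i j - a)))) :=
      Real.measurable_exp.comp ((((hm i j).sub_const a).const_mul s).const_mul _)
    have l := ha s hs
    have lt : ENNReal.ofReal MM * volume (BB P R) < ⊤ :=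
      ENNReal.mul_lt_top ENNReal.ofReal_lt_top fin.lt_top
    constructor
    · refine ⟨m.aestronglyMeasurable, ?_⟩
      rw [hasFiniteIntegral_iff_ofReal (Filter.Eventually.of_forall fun _ => (Real.exp_pos _).le)]
      exact l.trans_lt lt
    · rw [integral_eq_lintegral_of_nonneg_ae (Filter.Eventually.of_forall fun _ => (Real.exp_pos _).le)
        m.aestronglyMeasurable]
      have := ENNReal.toReal_mono lt.ne l
      rwa [ENNReal.toReal_mul, ENNReal.toReal_ofReal MM_pos.le] at this
  have k1 := key 1 (Or.inl rfl)
  have k2 := key (-1) (Or.inr rfl)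
  have gi : IntegrableOn (fun Q => gg τ a (Jf Q i j)) (BB P R) := k1.1.add k2.1
  have gI : ∫ Q in BB P R, gg τ a (Jf Q i j) ≤ 2 * MM * (volume (BB P R)).toReal := by
    unfold gg
    rw [integral_add k1.1 k2.1]
    linarith [k1.2, k2.2]
  refine ⟨a, gi, gI, ?_⟩
  have di : IntegrableOn (fun Q => Jf Q i j - a) (BB P R) := by
    refine Integrable.mono' (gi.const_mul τ) ((hm i j).sub_const a).aestronglyMeasurable
      (Filter.Eventually.of_forall fun Q => ?_)
    exact gg_abs tp a _
  have ci : IntegrableOn (fun _ : H => a) (BB P R) := integrableOn_const fin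
  have e : ∫ Q in BB P R, Jf Q i j = (∫ Q in BB P R, (Jf Q i j - a)) + (volume (BB P R)).toReal * a := by
    have : ∫ Q in BB P R, Jf Q i j = ∫ Q in BB P R, ((Jf Q i j - a) + a) := by simp
    rw [this, integral_add di ci, setIntegral_const, smul_eq_mul]; rfl
  rw [e, mul_add, ← mul_assoc, inv_mul_cancel₀ Vp.ne', one_mul, add_sub_cancel_right, abs_mul,
    abs_of_pos (inv_pos.2 Vp), inv_mul_le_iff₀ Vp]
  calc |∫ Q in BB P R, (Jf Q i j - a)| ≤ ∫ Q in BB P R, τ * gg τ a (Jf Q i j) := by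
        rw [← Real.norm_eq_abs]
        exact norm_integral_le_of_norm_le (gi.const_mul τ)
          (Filter.Eventually.of_forall fun Q => gg_abs tp a _)
    _ = τ * ∫ Q in BB P R, gg τ a (Jf Q i j) := integral_const_mul _ _
    _ ≤ τ * (2 * MM * (volume (BB P R)).toReal) := mul_le_mul_of_nonneg_left gI tp.le
    _ = _ := by ring

lemma matOpNorm_le (A : Matrix (Fin 2) (Fin 2) ℝ) :
    matOpNorm A ≤ |A 0 0| + |A 0 1| + (|A 1 0| + |A 1 1|) := by
  apply Real.sSup_le _ (by positivity)
  rintro r ⟨x, y, hxy, rfl⟩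
  have hx : |x| ≤ 1 := abs_le_of_sq_le_sq (by nlinarith [sq_nonneg y]) (by norm_num)
  have hy : |y| ≤ 1 := abs_le_of_sq_le_sq (by nlinarith [sq_nonneg x]) (by norm_num)
  have b : ∀ p q : ℝ, |p * x + q * y| ≤ |p| + |q| := fun p q => by
    refine (abs_add_le _ _).trans ?_
    rw [abs_mul, abs_mul]
    nlinarith [abs_nonneg p, abs_nonneg q]
  have h1 := b (A 0 0) (A 0 1)
  have h2 := b (A 1 0) (A 1 1)
  rw [Real.sqrt_le_iff]
  refine ⟨by positivity, ?_⟩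
  rw [← sq_abs (A 0 0 * x + A 0 1 * y), ← sq_abs (A 1 0 * x + A 1 1 * y)]
  have n1 := abs_nonneg (A 0 0 * x + A 0 1 * y)
  have n2 := abs_nonneg (A 1 0 * x + A 1 1 * y)
  have : (|A 0 0 * x + A 0 1 * y| + |A 1 0 * x + A 1 1 * y|) ^ 2 ≤
      (|A 0 0| + |A 0 1| + (|A 1 0| + |A 1 1|)) ^ 2 :=
    pow_le_pow_left₀ (by positivity) (by linarith) 2
  nlinarith

lemma exp_half (a b : ℝ) : Real.exp ((a + b) / 2) ≤ (Real.exp a + Real.exp b) / 2 := by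
  have e1 : Real.exp a = Real.exp (a / 2) ^ 2 := by rw [← Real.exp_nat_mul]; congr 1; push_cast; ring
  have e2 : Real.exp b = Real.exp (b / 2) ^ 2 := by rw [← Real.exp_nat_mul]; congr 1; push_cast; ring
  rw [e1, e2, add_div, Real.exp_add]
  nlinarith [sq_nonneg (Real.exp (a / 2) - Real.exp (b / 2))]

lemma exp_frac (u : ℝ) {N : ℝ} (hN : 1 ≤ N) : Real.exp (u / N) ≤ 1 + Real.exp u / N := by
  have hNp : 0 < N := by linarith
  have h1 : N⁻¹ ≤ 1 := inv_le_one_of_one_le₀ hN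
  have h0 : 0 < N⁻¹ := inv_pos.2 hNp
  have := convexOn_exp.2 (Set.mem_univ u) (Set.mem_univ 0) h0.le (by linarith : 0 ≤ 1 - N⁻¹) (by ring)
  simp only [smul_eq_mul, mul_zero, add_zero, Real.exp_zero, mul_one] at this
  rw [div_eq_inv_mul, div_eq_inv_mul]; linarith

lemma exp_four (a b c d : ℝ) {N : ℝ} (hN : 1 ≤ N) :
    Real.exp ((a + b + (c + d)) / (4 * N)) ≤
      1 + (Real.exp a + Real.exp b + (Real.exp c + Real.exp d)) / (4 * N) := by
  have hNp : 0 < N := by linarith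
  have h1 := exp_half ((a / N + b / N) / 2) ((c / N + d / N) / 2)
  have h2 := exp_half (a / N) (b / N)
  have h3 := exp_half (c / N) (d / N)
  have e : ((a / N + b / N) / 2 + (c / N + d / N) / 2) / 2 = (a + b + (c + d)) / (4 * N) := by
    field_simp; ring
  rw [e] at h1
  have k1 := exp_frac a hN
  have k2 := exp_frac b hN
  have k3 := exp_frac c hN
  have k4 := exp_frac d hN
  have e2 : (Real.exp a + Real.exp b + (Real.exp c + Real.exp d)) / (4 * N) =
    (Real.exp a / N + Real.exp b / N + (Real.exp c / N + Real.exp d / N)) / 4 := by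
    field_simp
  rw [e2]; linarith

lemma final {f : H → H} {τ : ℝ} (h : Good f τ) {T : ℝ} (hT : τ ≤ T) {R : ℝ} (hR : 0 < R) (P : H)
    (Jf : H → Matrix (Fin 2) (Fin 2) ℝ) (hm : ∀ i j : Fin 2, Measurable fun P : H => Jf P i j)
    (hJ : ∀ᵐ P ∂volume, HasPansuJacobianAt f (Jf P) P) :
    (volume (BB P R)).toReal⁻¹ * ∫ Q in BB P R,
      Real.exp (matOpNorm (Jf Q - Matrix.of fun i j =>
        (volume (BB P R)).toReal⁻¹ * ∫ Q' in BB P R, Jf Q' i j) / (32 * MM * T)) ≤ 2 := by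
  have tp := h.pos
  have fin := BB_fin P hR
  have Vp := BB_pos P hR
  have Mp := MM_pos
  have M1 := MM_one
  choose a gi gI ga using J_int h hR P Jf hm hJ
  set V := (volume (BB P R)).toReal with hV
  set G : H → ℝ := fun Q => gg τ (a 0 0) (Jf Q 0 0) + gg τ (a 0 1) (Jf Q 0 1) +
    (gg τ (a 1 0) (Jf Q 1 0) + gg τ (a 1 1) (Jf Q 1 1)) with hG
  have Gi : IntegrableOn G (BB P R) := ((gi 0 0).add (gi 0 1)).add ((gi 1 0).add (gi 1 1))
  have GI : ∫ Q in BB P R, G Q ≤ 8 * MM * V := by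
    have e : ∫ Q in BB P R, G Q = (∫ Q in BB P R, gg τ (a 0 0) (Jf Q 0 0)) +
      (∫ Q in BB P R, gg τ (a 0 1) (Jf Q 0 1)) + ((∫ Q in BB P R, gg τ (a 1 0) (Jf Q 1 0)) +
      (∫ Q in BB P R, gg τ (a 1 1) (Jf Q 1 1))) := by
      have s1 := integral_add ((gi 0 0).add (gi 0 1)) ((gi 1 0).add (gi 1 1))
      have s2 := integral_add (gi 0 0) (gi 0 1)
      have s3 := integral_add (gi 1 0) (gi 1 1)
      rw [← s2, ← s3]; exact s1
    rw [e]
    linarith [gI 0 0, gI 0 1, gI 1 0, gI 1 1]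
  set Z : Matrix (Fin 2) (Fin 2) ℝ := Matrix.of fun i j => V⁻¹ * ∫ Q' in BB P R, Jf Q' i j with hZ
  have zb : ∀ i j, |Z i j - a i j| ≤ 2 * MM * τ := fun i j => ga i j
  have pt : ∀ Q, Real.exp (matOpNorm (Jf Q - Z) / (32 * MM * T)) ≤
      1.6 * (1 + G Q / (32 * MM)) := by
    intro Q
    have n1 := matOpNorm_le (Jf Q - Z)
    have b : ∀ i j, |(Jf Q - Z) i j| ≤ |Jf Q i j - a i j| + 2 * MM * τ := fun i j => by
      have := abs_sub_le (Jf Q i j) (a i j) (Z i j)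
      rw [abs_sub_comm (a i j)] at this
      rw [Matrix.sub_apply]
      linarith [zb i j]
    set w : Fin 2 → Fin 2 → ℝ := fun i j => |Jf Q i j - a i j| / τ with hw
    have bw' : ∀ i j, |(Jf Q - Z) i j| ≤ τ * w i j + 2 * MM * τ := fun i j => by
      have : τ * w i j = |Jf Q i j - a i j| := by simp only [hw]; field_simp
      rw [this]; exact b i j
    set S := w 0 0 + w 0 1 + (w 1 0 + w 1 1) with hS
    have n2 : matOpNorm (Jf Q - Z) ≤ τ * (S + 8 * MM) := by
      have b1 := bw' 0 0
      have b2 := bw' 0 1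
      have b3 := bw' 1 0
      have b4 := bw' 1 1
      rw [hS]; linarith
    have w0 : ∀ i j, 0 ≤ w i j := fun i j => by simp only [hw]; positivity
    have S0 : 0 ≤ S := by
      have := w0 0 0
      have := w0 0 1
      have := w0 1 0
      have := w0 1 1
      linarith
    have n3 : matOpNorm (Jf Q - Z) / (32 * MM * T) ≤ S / (4 * (8 * MM)) + 1 / 4 := by
      have Tp : 0 < T := by linarith
      have e : S / (4 * (8 * MM)) + 1 / 4 = (T * (S + 8 * MM)) / (32 * MM * T) := by
        field_simp; ring
      rw [e]
      apply div_le_div_of_nonneg_right _ (by positivity)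
      exact n2.trans (mul_le_mul_of_nonneg_right hT (by linarith))
    refine (Real.exp_le_exp.2 n3).trans ?_
    rw [Real.exp_add, mul_comm]
    have q : Real.exp (1 / 4) ≤ 1.6 := by
      have e4 : Real.exp (1 / 4) ^ 4 = Real.exp 1 := by rw [← Real.exp_nat_mul]; norm_num
      refine le_of_pow_le_pow_left₀ (n := 4) (by norm_num) (by norm_num) ?_
      rw [e4]
      have := Real.exp_one_lt_d9
      norm_num; linarith
    refine mul_le_mul q ?_ (Real.exp_pos _).le (by norm_num)
    refine (exp_four _ _ _ _ (by linarith : 1 ≤ 8 * MM)).trans ?_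
    rw [show 4 * (8 * MM) = 32 * MM by ring]
    gcongr
    simp only [hG, hw]
    have := gg_exp tp (a 0 0) (Jf Q 0 0)
    have := gg_exp tp (a 0 1) (Jf Q 0 1)
    have := gg_exp tp (a 1 0) (Jf Q 1 0)
    have := gg_exp tp (a 1 1) (Jf Q 1 1)
    linarith
  have ci : IntegrableOn (fun _ : H => (1:ℝ)) (BB P R) := integrableOn_const fin
  have Ri : IntegrableOn (fun Q => 1.6 * (1 + G Q / (32 * MM))) (BB P R) :=
    (ci.add (Gi.div_const _)).const_mul _
  have mono : ∫ Q in BB P R, Real.exp (matOpNorm (Jf Q - Z) / (32 * MM * T)) ≤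
      ∫ Q in BB P R, 1.6 * (1 + G Q / (32 * MM)) :=
    integral_mono_of_nonneg (Filter.Eventually.of_forall fun _ => (Real.exp_pos _).le) Ri
      (Filter.Eventually.of_forall pt)
  have val : ∫ Q in BB P R, 1.6 * (1 + G Q / (32 * MM)) =
      1.6 * (V + (∫ Q in BB P R, G Q) / (32 * MM)) := by
    rw [integral_const_mul, integral_add ci (Gi.div_const _), integral_div, setIntegral_const,
      smul_eq_mul, mul_one]; rfl
  rw [val] at mono
  rw [inv_mul_le_iff₀ Vp]
  refine mono.trans ?_
  have : (∫ Q in BB P R, G Q) / (32 * MM) ≤ V / 4 := by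
    rw [div_le_iff₀ (by positivity)]; linarith
  linarith

/-- exponential integrability of the Pansu Jacobian: BMO and
John–Nirenberg. There are `ε₀, C > 0` such that if `ε ≤ ε₀` and `f` is
`(1+ε)`-biLipschitz, then for every metric ball `B ⊆ ℍ`,
`(1/ℒ(B)) ∫_B exp(‖Jf(Q) − (Jf)_B‖/(C ε^{1/4096})) dQ ≤ 2`, where `(Jf)_B` is
the average of `Jf` over `B`. -/
theorem statement8 :
    ∃ ε₀ > (0:ℝ), ∃ C > (0:ℝ),
      ∀ ε : ℝ, 0 ≤ ε → ε ≤ ε₀ →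
      ∀ f : H → H, IsBiLip ε f →
      ∀ Jf : H → Matrix (Fin 2) (Fin 2) ℝ,
        (∀ i j : Fin 2, Measurable fun P : H => Jf P i j) →
        (∀ᵐ P ∂volume, HasPansuJacobianAt f (Jf P) P) →
      ∀ (P₀ : H) (R : ℝ), 0 < R →
        (volume {Q : H | dH P₀ Q < R}).toReal⁻¹ *
            ∫ Q in {Q : H | dH P₀ Q < R},
              Real.exp (matOpNorm (Jf Q -
                  Matrix.of fun i j =>
                    (volume {Q' : H | dH P₀ Q' < R}).toReal⁻¹ *
                      ∫ Q' in {Q' : H | dH P₀ Q' < R}, Jf Q' i j)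
                / (C * ε ^ ((1:ℝ)/4096)))
          ≤ 2 := by
  refine ⟨(1 / 1000) ^ 8, by positivity, 32 * MM, by have := MM_pos; positivity, ?_⟩
  intro ε h0 hε f hf Jf hm hJ P₀ R hR
  rcases h0.eq_or_lt with rfl | hp
  · have Vp := BB_pos P₀ hR
    rw [Real.zero_rpow (by norm_num)]
    simp only [mul_zero, div_zero, Real.exp_zero]
    rw [setIntegral_const, smul_eq_mul, mul_one]
    change (volume (BB P₀ R)).toReal⁻¹ * (volume (BB P₀ R)).toReal ≤ 2
    rw [inv_mul_cancel₀ Vp.ne']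
    norm_num
  · set τ := ε ^ ((1:ℝ) / 8) with hτ
    have tp : 0 < τ := Real.rpow_pos_of_pos hp _
    have t8 : τ ^ 8 = ε := by
      rw [hτ, ← Real.rpow_natCast, ← Real.rpow_mul h0]; norm_num
    have ts : τ ≤ 1 / 1000 := by
      refine le_of_pow_le_pow_left₀ (n := 8) (by norm_num) (by norm_num) ?_
      rw [t8]; exact hε
    have hg : Good f τ := ⟨tp, ts, by rwa [t8]⟩
    have hT : τ ≤ ε ^ ((1:ℝ) / 4096) :=
      Real.rpow_le_rpow_of_exponent_ge hp (hε.trans (by norm_num)) (by norm_num)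
    exact final hg hT hR P₀ Jf hm hJ
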